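/- arXiv:2108.08705 — 17 statements merged into one kernel-verified Lean document; each statement's English description precedes it below -/
import Mathlib

section
/- The Diophantine equation y·(x² − y) = z² + 1 has no integer solutions; that is, there are no integers x, y, z such that y·(x² − y) = z² + 1. -/
/-- A natural number dividing some `z ^ 2 + 1` is not congruent to `3` modulo `4`. -/
theorem Nat.mod_four_ne_three_of_dvd_sq_add_one {n : ℕ} {z : ℤ} (h : (n : ℤ) ∣ z ^ 2 + 1) :
    n % 4 ≠ 3 := by
  have hz : ((z ^ 2 + 1 : ℤ) : ZMod n) = 0 := (CharP.intCast_eq_zero_iff (ZMod n) n _).2 h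
  push_cast at hz
  have hsq : IsSquare (-1 : ZMod n) := ⟨z, by linear_combination -hz⟩
  obtain ⟨a, b, rfl⟩ := Nat.eq_sq_add_sq_of_isSquare_mod_neg_one hsq
  have ha := Nat.mod_lt a (show 4 > 0 by norm_num)
  have hb := Nat.mod_lt b (show 4 > 0 by norm_num)
  rw [Nat.add_mod, Nat.pow_mod a, Nat.pow_mod b]
  interval_cases a % 4 <;> interval_cases b % 4 <;> norm_num

/-- A positive integer dividing some `z ^ 2 + 1` is not congruent to `3` modulo `4`. -/
theorem Int.emod_four_ne_three_of_dvd_sq_add_one {n z : ℤ} (hn : 0 < n) (h : n ∣ z ^ 2 + 1) :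
    n % 4 ≠ 3 := by
  lift n to ℕ using hn.le
  have := Nat.mod_four_ne_three_of_dvd_sq_add_one h
  omega

/-- The Diophantine equation y·(x² − y) = z² + 1 has no integer solutions. -/
theorem no_solutions_y_xsq_sub_y_eq_zsq_add_one :
    ¬ ∃ x y z : ℤ, y * (x ^ 2 - y) = z ^ 2 + 1 := by
  rintro ⟨x, y, z, h⟩
  have hy : 0 < y := by nlinarith [sq_nonneg x, sq_nonneg y, sq_nonneg z]
  have hw : 0 < x ^ 2 - y := pos_of_mul_pos_right (h ▸ by positivity) hy.le
  have hy3 := Int.emod_four_ne_three_of_dvd_sq_add_one hy (Dvd.intro _ h)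
  have hw3 := Int.emod_four_ne_three_of_dvd_sq_add_one hw (Dvd.intro_left _ h)
  have hmod : y * (x ^ 2 - y) % 4 = (z ^ 2 + 1) % 4 := by rw [h]
  have hx : x ^ 2 % 4 = 0 ∨ x ^ 2 % 4 = 1 := by
    rcases Int.even_or_odd' x with ⟨k, rfl | rfl⟩ <;> ring_nf <;> omega
  have hz : z ^ 2 % 4 = 0 ∨ z ^ 2 % 4 = 1 := by
    rcases Int.even_or_odd' z with ⟨k, rfl | rfl⟩ <;> ring_nf <;> omega
  rw [Int.mul_emod] at hmod
  have : y % 4 = 0 ∨ y % 4 = 1 ∨ y % 4 = 2 := by omega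
  rcases this with hy' | hy' | hy' <;> rcases hx with hx | hx <;>
    rw [hy', Int.sub_emod, hx, hy'] at hmod <;> omega
end

section
/- The Diophantine equation y·(x² + 3) = z² + 1 has no integer solutions; that is, there are no integers x, y, z such that y·(x² + 3) = z² + 1. -/
/-- The Diophantine equation y·(x² + 3) = z² + 1 has no integer solutions. -/
theorem no_solutions_y_xsq_add_three_eq_zsq_add_one :
    ¬ ∃ x y z : ℤ, y * (x ^ 2 + 3) = z ^ 2 + 1 := by
  rintro ⟨x, y, z, h⟩
  rcases Int.even_or_odd' x with ⟨k, rfl | rfl⟩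
  · have hn : (((2 * k).natAbs ^ 2 + 3 : ℕ) : ℤ) = (2 * k) ^ 2 + 3 := by
      push_cast
      rw [sq_abs]
    refine Nat.mod_four_ne_three_of_dvd_sq_add_one (z := z)
      (hn ▸ Dvd.intro_left y h) ?_
    have : (2 * k) ^ 2 = 4 * k ^ 2 := by ring
    lia
  · have h4 : y * ((2 * k + 1) ^ 2 + 3) = 4 * (y * (k ^ 2 + k + 1)) := by ring
    rcases Int.even_or_odd' z with ⟨m, rfl | rfl⟩
    · have : (2 * m) ^ 2 = 4 * m ^ 2 := by ring
      lia
    · have : (2 * m + 1) ^ 2 = 4 * (m ^ 2 + m) + 1 := by ring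
      lia
end

section
/- The Diophantine equation y·(x² + 2) = 2z² − 1 has no integer solutions; that is, there are no integers x, y, z such that y·(x² + 2) = 2z² − 1. -/
/-- `2` is a quadratic non-residue, in the sense of the Jacobi symbol, modulo `b ≡ 3 [MOD 8]`. -/
theorem jacobiSym_two_of_mod_eight_eq_three {b : ℕ} (hb : b % 8 = 3) : jacobiSym 2 b = -1 := by
  rw [jacobiSym.at_two (Nat.odd_iff.mpr (by lia)), ZMod.χ₈_nat_eq_if_mod_eight,
    if_neg (by lia), if_neg (by lia)]

/-- A natural number congruent to `3` modulo `8` does not divide any `2 * z ^ 2 - 1`. -/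
theorem not_dvd_two_mul_sq_sub_one {b : ℕ} (hb : b % 8 = 3) (z : ℤ) :
    ¬ (b : ℤ) ∣ 2 * z ^ 2 - 1 := by
  intro h
  have hJ : jacobiSym (2 * z ^ 2) b = jacobiSym 1 b :=
    jacobiSym.mod_left' (Int.emod_eq_emod_iff_emod_sub_eq_zero.mpr (Int.emod_eq_zero_of_dvd h))
  rw [jacobiSym.mul_left, jacobiSym.pow_left, jacobiSym.one_left,
    jacobiSym_two_of_mod_eight_eq_three hb] at hJ
  linarith [sq_nonneg (jacobiSym z b)]

/-- The Diophantine equation y·(x² + 2) = 2z² − 1 has no integer solutions. -/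
theorem no_solutions_y_xsq_add_two_eq_two_zsq_sub_one :
    ¬ ∃ x y z : ℤ, y * (x ^ 2 + 2) = 2 * z ^ 2 - 1 := by
  rintro ⟨x, y, z, h⟩
  have hx : Odd x := by
    by_contra hx
    obtain ⟨k, rfl⟩ := Int.not_odd_iff_even.mp hx
    have : 2 * (y * (2 * k ^ 2 + 1)) = 2 * z ^ 2 - 1 := by linarith
    lia
  have hcast : ((x.natAbs ^ 2 + 2 : ℕ) : ℤ) = x ^ 2 + 2 := by simp
  have hmod : (x.natAbs ^ 2 + 2) % 8 = 3 := by
    have := Int.eight_dvd_sq_sub_one_of_odd hx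
    zify
    simp only [sq_abs]
    lia
  exact not_dvd_two_mul_sq_sub_one hmod z (hcast ▸ ⟨y, by linarith⟩)
end

section
/- Let a, b, c be integers with gcd(a, b, c) = 1, and let D = b² − 4ac. Let p be a prime, and let x, y be integers such that p divides a·x² + b·x·y + c·y². Then either p divides 2D, or there exists an integer z with z² ≡ D (mod p), or p divides both x and y. -/
/-- If a prime `p` divides `w² - D y²` but not `y`, then `D` is a square modulo `p`. -/
theorem exists_dvd_sq_sub_of_dvd_sq_sub_mul_sq {p : ℕ} (hp : p.Prime) {D w y : ℤ}
    (hdvd : (p : ℤ) ∣ w ^ 2 - D * y ^ 2) (hy : ¬ (p : ℤ) ∣ y) :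
    ∃ z : ℤ, (p : ℤ) ∣ z ^ 2 - D := by
  obtain ⟨u, v, huv⟩ := (Nat.prime_iff_prime_int.mp hp).irreducible.coprime_iff_not_dvd.mpr hy
  obtain ⟨k, hk⟩ := hdvd
  refine ⟨w * v, k * v ^ 2 + D * (u ^ 2 * p - 2 * u), ?_⟩
  linear_combination v ^ 2 * hk + D * (v * y + 1 - u * p) * huv

/-- Prime factors of binary quadratic forms: if gcd(a,b,c) = 1, D = b² − 4ac,
and a prime p divides a·x² + b·x·y + c·y², then either p divides 2D, or D is a
quadratic residue mod p, or p divides both x and y. -/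
theorem prime_factor_of_quadratic_form (a b c : ℤ) (h : Int.gcd a (Int.gcd b c) = 1)
    (D : ℤ) (hD : D = b ^ 2 - 4 * a * c) (p : ℕ) (hp : p.Prime) (x y : ℤ)
    (hdvd : (p : ℤ) ∣ a * x ^ 2 + b * x * y + c * y ^ 2) :
    (p : ℤ) ∣ 2 * D ∨ (∃ z : ℤ, (p : ℤ) ∣ z ^ 2 - D) ∨ ((p : ℤ) ∣ x ∧ (p : ℤ) ∣ y) := by
  right
  have hy : (p : ℤ) ∣ (2 * a * x + b * y) ^ 2 - D * y ^ 2 := by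
    obtain ⟨k, hk⟩ := hdvd
    exact ⟨4 * a * k, by rw [hD]; linear_combination 4 * a * hk⟩
  have hx : (p : ℤ) ∣ (2 * c * y + b * x) ^ 2 - D * x ^ 2 := by
    obtain ⟨k, hk⟩ := hdvd
    exact ⟨4 * c * k, by rw [hD]; linear_combination 4 * c * hk⟩
  by_cases hpx : (p : ℤ) ∣ x
  · by_cases hpy : (p : ℤ) ∣ y
    · exact Or.inr ⟨hpx, hpy⟩
    · exact Or.inl (exists_dvd_sq_sub_of_dvd_sq_sub_mul_sq hp hy hpy)
  · exact Or.inl (exists_dvd_sq_sub_of_dvd_sq_sub_mul_sq hp hx hpx)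
end

section
/- The Diophantine equation x² + y² − z² = x·y·z − 2 has no integer solutions; that is, there are no integers x, y, z such that x² + y² − z² = x·y·z − 2. -/
/-- No square is exactly two less than another square. -/
lemma sq_ne_sq_sub_two (b z : ℤ) : b ^ 2 ≠ z ^ 2 - 2 := by
  intro h
  rcases Int.even_or_odd' b with ⟨c, rfl | rfl⟩ <;>
    rcases Int.even_or_odd' z with ⟨d, rfl | rfl⟩ <;>
    ring_nf at h <;> omega

/-- Jumping in `z`: a solution whose coordinates `x = a` and `y = -b` have opposite signs
yields a solution with a smaller positive `z`. -/
lemma exists_smaller_of_opposite_signs {a b z : ℤ} (ha : 0 ≤ a) (hb : 0 ≤ b) (hz : 0 < z)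
    (h : a ^ 2 + b ^ 2 + z * a * b = z ^ 2 - 2) :
    ∃ w, 0 < w ∧ w < z ∧ a ^ 2 + b ^ 2 - w ^ 2 = a * b * w - 2 := by
  rcases ha.eq_or_lt with rfl | ha
  · exact absurd (by linarith) (sq_ne_sq_sub_two b z)
  rcases hb.eq_or_lt with rfl | hb
  · exact absurd (by linarith) (sq_ne_sq_sub_two a z)
  refine ⟨z - a * b, ?_, ?_, ?_⟩
  · refine pos_of_mul_pos_right (a := z) ?_ hz.le
    nlinarith [sq_nonneg a, sq_nonneg b]
  · linarith [mul_pos ha hb]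
  · linarith

/-- Jumping in `x`: a positive solution descends, for fixed `z`, to one with opposite signs. -/
lemma exists_opposite_signs_of_pos {z : ℤ} (hz : 0 < z) (n : ℕ) :
    ∀ x y : ℤ, 0 < x → 0 < y → x + y ≤ n → x ^ 2 + y ^ 2 - z ^ 2 = x * y * z - 2 →
      ∃ a b : ℤ, 0 ≤ a ∧ 0 ≤ b ∧ a ^ 2 + b ^ 2 + z * a * b = z ^ 2 - 2 := by
  induction n with
  | zero => intro x y hx hy hn; omega
  | succ n ih =>
    intro x y hx hy hn h
    wlog hyx : y ≤ x generalizing x y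
    · exact this y x hy hx (by omega) (by linarith) (by omega)
    have hprod : x * (z * y - x) = y ^ 2 - z ^ 2 + 2 := by linarith
    rcases le_or_gt (z * y - x) 0 with hneg | hpos
    · exact ⟨x - z * y, y, by linarith, hy.le, by linarith⟩
    have hz3 : 3 ≤ z := by
      by_contra! hlt
      interval_cases z
      · nlinarith [sq_nonneg (x - y), mul_pos hx hy]
      · exact sq_ne_sq_sub_two (x - y) 2 (by linarith)
    have hlt : z * y - x < x := by nlinarith
    exact ih (z * y - x) y hpos hy (by push_cast at hn; omega) (by linarith)

lemma no_solution_of_pos (n : ℕ) :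
    ∀ x y z : ℤ, 0 < z → z ≤ n → x ^ 2 + y ^ 2 - z ^ 2 ≠ x * y * z - 2 := by
  induction n with
  | zero => intro x y z hz hn; omega
  | succ n ih =>
    intro x y z hz hn h
    have key : ∀ a b : ℤ, 0 ≤ a → 0 ≤ b → a ^ 2 + b ^ 2 + z * a * b ≠ z ^ 2 - 2 := by
      intro a b ha hb hab
      obtain ⟨w, hw, hwz, hw'⟩ := exists_smaller_of_opposite_signs ha hb hz hab
      exact ih a b w hw (by push_cast at hn; omega) hw'
    have key' : ∀ a b : ℤ, 0 < a → 0 < b → a ^ 2 + b ^ 2 - z ^ 2 ≠ a * b * z - 2 := by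
      intro a b ha hb hab
      obtain ⟨c, d, hc, hd, hcd⟩ :=
        exists_opposite_signs_of_pos hz (a + b).toNat a b ha hb (by omega) hab
      exact key c d hc hd hcd
    rcases le_or_gt x 0 with hx | hx <;> rcases le_or_gt y 0 with hy | hy
    · rcases hx.eq_or_lt with rfl | hx
      · exact key 0 (-y) le_rfl (by linarith) (by linarith)
      rcases hy.eq_or_lt with rfl | hy
      · exact key (-x) 0 (by linarith) le_rfl (by linarith)
      exact key' (-x) (-y) (by linarith) (by linarith) (by linarith)
    · exact key (-x) y (by linarith) hy.le (by linarith)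
    · exact key x (-y) hx.le (by linarith) (by linarith)
    · exact key' x y hx hy h

/-- The Markoff-type equation x² + y² − z² = x·y·z − 2 has no integer solutions. -/
theorem no_solutions_markoff_type_h22 :
    ¬ ∃ x y z : ℤ, x ^ 2 + y ^ 2 - z ^ 2 = x * y * z - 2 := by
  rintro ⟨x, y, z, h⟩
  rcases lt_trichotomy z 0 with hz | rfl | hz
  · exact no_solution_of_pos (-z).toNat (-x) y (-z) (by omega) (by omega) (by linarith)
  · nlinarith [sq_nonneg x, sq_nonneg y]
  · exact no_solution_of_pos z.toNat x y z hz (by omega) h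
end

section
/- The Diophantine equation x² + y² + z² + t² = x·y·z·t − 2 has no integer solutions; that is, there are no integers x, y, z, t such that x² + y² + z² + t² = x·y·z·t − 2. -/
/-- There is no positive solution with `x ≤ y ≤ z ≤ t` that the Vieta jump in `t` does not shrink. -/
theorem markoff_four_no_reduced_of_sorted {x y z t : ℤ} (hx : 0 < x) (hxy : x ≤ y) (hyz : y ≤ z)
    (hzt : z ≤ t) (h2t : 2 * t ≤ x * y * z)
    (h : x ^ 2 + y ^ 2 + z ^ 2 + t ^ 2 + 2 = x * y * z * t) : False := by
  have hkey : x * y * z ^ 2 ≤ 2 * z ^ 2 + x ^ 2 + y ^ 2 + 2 := by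
    nlinarith [mul_nonneg (sub_nonneg.2 hzt) (by linarith : 0 ≤ x * y * z - t - z)]
  have hx2 : x ^ 2 ≤ z ^ 2 := by gcongr; exact hxy.trans hyz
  have hy2 : y ^ 2 ≤ z ^ 2 := by gcongr; linarith
  obtain rfl | hz : z = 1 ∨ 2 ≤ z := by lia
  · obtain rfl : y = 1 := by lia
    obtain rfl : x = 1 := by lia
    lia
  have hxy4 : x * y ≤ 4 := by
    by_contra! hlt
    nlinarith [mul_nonneg (by linarith : 0 ≤ x * y - 5) (sq_nonneg z)]
  have hx3 : x ≤ 2 := by nlinarith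
  have hy4 : y ≤ 4 := by nlinarith
  interval_cases x <;> interval_cases y
  · lia
  · obtain rfl : t = z := by lia
    nlinarith
  · obtain rfl : z = 3 := by nlinarith
    have ht : t ≤ 4 := by lia
    interval_cases t <;> lia
  · nlinarith
  · obtain rfl : z = 2 := by nlinarith
    have ht : t ≤ 4 := by lia
    interval_cases t <;> lia
  all_goals lia

/-- A positive solution with largest entry `t` is shrunk by the Vieta jump in `t`. -/
theorem markoff_four_lt_of_max {x y z t : ℤ} (hx : 0 < x) (hy : 0 < y) (hz : 0 < z)
    (hxt : x ≤ t) (hyt : y ≤ t) (hzt : z ≤ t)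
    (h : x ^ 2 + y ^ 2 + z ^ 2 + t ^ 2 + 2 = x * y * z * t) : x * y * z < 2 * t := by
  by_contra! h2t
  rcases le_total x y with hxy | hxy <;> rcases le_total y z with hyz | hyz <;>
    rcases le_total x z with hxz | hxz
  · exact markoff_four_no_reduced_of_sorted hx hxy hyz hzt h2t h
  · exact markoff_four_no_reduced_of_sorted hx hxy hyz hzt h2t h
  · exact markoff_four_no_reduced_of_sorted hx hxz hyz hyt (by linarith) (by linarith)
  · exact markoff_four_no_reduced_of_sorted hz hxz hxy hyt (by linarith) (by linarith)
  · exact markoff_four_no_reduced_of_sorted hy hxy hxz hzt (by linarith) (by linarith)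
  · exact markoff_four_no_reduced_of_sorted hy hyz hxz hxt (by linarith) (by linarith)
  · exact markoff_four_no_reduced_of_sorted hz hyz hxy hxt (by linarith) (by linarith)
  · exact markoff_four_no_reduced_of_sorted hz hyz hxy hxt (by linarith) (by linarith)

/-- A positive solution with largest entry `t` yields another with `t` replaced by something
smaller. -/
theorem markoff_four_exists_lt_of_max {x y z t : ℤ} (hx : 0 < x) (hy : 0 < y) (hz : 0 < z)
    (hxt : x ≤ t) (hyt : y ≤ t) (hzt : z ≤ t)
    (h : x ^ 2 + y ^ 2 + z ^ 2 + t ^ 2 + 2 = x * y * z * t) :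
    ∃ s, 0 < s ∧ s < t ∧ x ^ 2 + y ^ 2 + z ^ 2 + s ^ 2 + 2 = x * y * z * s := by
  refine ⟨x * y * z - t, ?_, ?_, by linear_combination h⟩
  · have ht : 0 < t := hx.trans_le hxt
    refine pos_of_mul_pos_right (a := t) ?_ ht.le
    have : t * (x * y * z - t) = x ^ 2 + y ^ 2 + z ^ 2 + 2 := by linear_combination -h
    rw [this]
    positivity
  · linarith [markoff_four_lt_of_max hx hy hz hxt hyt hzt h]

theorem markoff_four_no_pos_solution (n : ℕ) : ∀ x y z t : ℤ, 0 < x → 0 < y → 0 < z → 0 < t →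
    x + y + z + t ≤ n → x ^ 2 + y ^ 2 + z ^ 2 + t ^ 2 + 2 ≠ x * y * z * t := by
  induction n with
  | zero => intros; lia
  | succ n ih =>
    have key : ∀ x y z t : ℤ, 0 < x → 0 < y → 0 < z → x ≤ t → y ≤ t → z ≤ t →
        x + y + z + t ≤ n + 1 → x ^ 2 + y ^ 2 + z ^ 2 + t ^ 2 + 2 ≠ x * y * z * t := by
      intro x y z t hx hy hz hxt hyt hzt hn h
      obtain ⟨s, hs, hst, h'⟩ := markoff_four_exists_lt_of_max hx hy hz hxt hyt hzt h
      exact ih x y z s hx hy hz hs (by lia) h'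
    intro x y z t hx hy hz ht hn h
    push_cast at hn
    obtain ⟨h₁, h₂, h₃⟩ | ⟨h₁, h₂, h₃⟩ | ⟨h₁, h₂, h₃⟩ | ⟨h₁, h₂, h₃⟩ :
        (x ≤ t ∧ y ≤ t ∧ z ≤ t) ∨ (x ≤ z ∧ y ≤ z ∧ t ≤ z) ∨ (x ≤ y ∧ z ≤ y ∧ t ≤ y) ∨
          (y ≤ x ∧ z ≤ x ∧ t ≤ x) := by lia
    · exact key x y z t hx hy hz h₁ h₂ h₃ hn h
    · exact key x y t z hx hy ht h₁ h₂ h₃ (by linarith) (by linarith)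
    · exact key x z t y hx hz ht h₁ h₂ h₃ (by linarith) (by linarith)
    · exact key y z t x hy hz ht h₁ h₂ h₃ (by linarith) (by linarith)

/-- The four-variable Markoff-type equation x² + y² + z² + t² = x·y·z·t − 2
has no integer solutions. -/
theorem no_solutions_markoff_type_four_var :
    ¬ ∃ x y z t : ℤ, x ^ 2 + y ^ 2 + z ^ 2 + t ^ 2 = x * y * z * t - 2 := by
  rintro ⟨x, y, z, t, h⟩
  have hpos : 0 < x * y * z * t := by nlinarith [sq_nonneg x, sq_nonneg y, sq_nonneg z, sq_nonneg t]
  have hne : ((x ≠ 0 ∧ y ≠ 0) ∧ z ≠ 0) ∧ t ≠ 0 := by simpa only [mul_ne_zero_iff] using hpos.ne'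
  obtain ⟨⟨⟨hx, hy⟩, hz⟩, ht⟩ := hne
  refine markoff_four_no_pos_solution (|x| + |y| + |z| + |t|).toNat |x| |y| |z| |t|
    (abs_pos.2 hx) (abs_pos.2 hy) (abs_pos.2 hz) (abs_pos.2 ht) (Int.self_le_toNat _) ?_
  rw [← abs_mul, ← abs_mul, ← abs_mul, abs_of_pos hpos]
  simp only [sq_abs]
  linarith
end

section
/- Let P be a polynomial with integer coefficients in n variables x₁, …, xₙ in which every variable xᵢ actually occurs (i.e., for each i there is a monomial of P with nonzero coefficient in which xᵢ appears). Define H(P) = Σ |aₘ|·2^{deg(m)}, the sum over all monomials m of P with nonzero coefficient aₘ, where deg(m) is the total degree of m. If either (a) H(P) ≤ 4n, or (b) P has total degree at least 3 and H(P) ≤ 4n + 4, then the equation P(x₁, …, xₙ) = 0 has an integer solution. -/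
open MvPolynomial Finset in
/-- If `x i` occurs with exponent one and a unit coefficient in a monomial that avoids the variables
of `S`, while every other monomial containing `x i` meets `S`, then setting the variables of `S`
to `0` and the others to `1` leaves an equation that can be solved for `x i`. -/
theorem exists_eval_eq_zero_of_isolated_monomial {σ : Type*} [Fintype σ] [DecidableEq σ]
    (P : MvPolynomial σ ℤ) (i : σ) (S : Finset σ) (hiS : i ∉ S) (m₀ : σ →₀ ℕ)
    (hcoeff : (P.coeff m₀).natAbs = 1) (hi : m₀ i = 1) (hS : ∀ j ∈ S, m₀ j = 0)
    (hother : ∀ m ∈ P.support, m ≠ m₀ → m i ≠ 0 → ∃ j ∈ S, m j ≠ 0) :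
    ∃ x : σ → ℤ, eval x P = 0 := by
  let w : ℤ → σ → ℤ := fun t => Function.update (fun j => if j ∈ S then 0 else 1) i t
  have hwi (t : ℤ) : w t i = t := by simp [w]
  have hw (t : ℤ) (j : σ) (hj : j ≠ i) : w t j = if j ∈ S then 0 else 1 := by simp [w, hj]
  have hm₀ (t : ℤ) : ∏ j, w t j ^ m₀ j = t := by
    rw [Fintype.prod_eq_single i, hwi, hi, pow_one]
    intro j hj
    by_cases hjS : j ∈ S <;> simp [hw t j hj, hS, hjS]
  have hterm (t : ℤ) (m : σ →₀ ℕ) (hm : m ∈ P.support) :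
      P.coeff m * ∏ j, w t j ^ m j =
        P.coeff m * ∏ j, w 0 j ^ m j + if m = m₀ then P.coeff m₀ * t else 0 := by
    by_cases h : m = m₀
    · subst h
      simp [hm₀]
    · rw [if_neg h, add_zero]
      congr 1
      by_cases hmi : m i = 0
      · refine Finset.prod_congr rfl fun j _ => ?_
        by_cases hj : j = i
        · simp [hj, hmi]
        · rw [hw t j hj, hw 0 j hj]
      · obtain ⟨j, hjS, hj⟩ := hother m hm h hmi
        have hji : j ≠ i := fun e => hiS (e ▸ hjS)
        have hzero (s : ℤ) : ∏ j, w s j ^ m j = 0 :=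
          Finset.prod_eq_zero (Finset.mem_univ j) (by simp [hw s j hji, hjS, hj])
        rw [hzero, hzero]
  have hmem : m₀ ∈ P.support := by
    rw [mem_support_iff]
    intro h
    simp [h] at hcoeff
  have heval (t : ℤ) : eval (w t) P = eval (w 0) P + P.coeff m₀ * t := by
    rw [eval_eq', eval_eq', Finset.sum_congr rfl (hterm t), Finset.sum_add_distrib]
    simp only [Finset.sum_ite_eq', if_pos hmem]
  refine ⟨w (-(P.coeff m₀ * eval (w 0) P)), ?_⟩
  rw [heval]
  rcases Int.natAbs_eq_iff.mp hcoeff with h | h <;> rw [h] <;> push_cast <;> ring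

theorem exists_eq_one_of_sum_eq_one {ι : Type*} {s : Finset ι} {f : ι → ℕ}
    (h : ∑ m ∈ s, f m = 1) : ∃ m ∈ s, f m = 1 ∧ ∀ m' ∈ s, m' ≠ m → f m' = 0 := by
  classical
  obtain ⟨m, hm, hne⟩ := Finset.exists_ne_zero_of_sum_ne_zero (h ▸ one_ne_zero)
  have hsum := Finset.add_sum_erase s f hm
  refine ⟨m, hm, by omega, fun m' hm' hne' => ?_⟩
  have hle := Finset.single_le_sum (f := f) (fun _ _ => Nat.zero_le _)
    (Finset.mem_erase.mpr ⟨hne', hm'⟩)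
  omega

theorem two_mul_le_two_pow (d : ℕ) : 2 * d ≤ 2 ^ d := by
  rcases d with _ | d
  · simp
  · have := Nat.lt_two_pow_self (n := d)
    rw [pow_succ]
    omega

theorem eight_le_two_pow_sub {d : ℕ} (hd : 4 ≤ d) : 8 ≤ 2 ^ d - 2 * d := by
  induction d, hd using Nat.le_induction with
  | base => norm_num
  | succ d _ ih =>
    rw [pow_succ]
    omega

/-- If every variable occurs in the polynomial P of n variables, and either
(a) H(P) ≤ 4n, or (b) P has total degree at least 3 and H(P) ≤ 4n + 4,
where H(P) = Σ |a_m|·2^(deg m) over the monomials of P, then the equation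
P = 0 has an integer solution. -/
theorem solvable_of_size_le_four_n_add_four {n : ℕ} (P : MvPolynomial (Fin n) ℤ)
    (hocc : ∀ i : Fin n, ∃ m ∈ P.support, m i ≠ 0)
    (h : (∑ m ∈ P.support, (P.coeff m).natAbs * 2 ^ (m.sum fun _ e => e)) ≤ 4 * n ∨
        (3 ≤ P.totalDegree ∧
          (∑ m ∈ P.support, (P.coeff m).natAbs * 2 ^ (m.sum fun _ e => e)) ≤ 4 * n + 4)) :
    ∃ x : Fin n → ℤ, MvPolynomial.eval x P = 0 := by
  by_contra hsol
  let a : (Fin n →₀ ℕ) → ℕ := fun m => (P.coeff m).natAbs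
  let d : (Fin n →₀ ℕ) → ℕ := fun m => ∑ i, m i
  let excess : (Fin n →₀ ℕ) → ℕ := fun m => a m * (2 ^ d m - 2 * d m)
  let occ : Fin n → ℕ := fun i => ∑ m ∈ P.support, a m * m i
  have ha_pos (m) (hm : m ∈ P.support) : 1 ≤ a m :=
    Nat.one_le_iff_ne_zero.mpr (Int.natAbs_ne_zero.mpr (MvPolynomial.mem_support_iff.mp hm))
  have hd (m : Fin n →₀ ℕ) : (m.sum fun _ e => e) = d m := Finsupp.sum_fintype _ _ fun _ => rfl
  have hsize : ∑ m ∈ P.support, (P.coeff m).natAbs * 2 ^ (m.sum fun _ e => e) =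
      2 * ∑ i, occ i + ∑ m ∈ P.support, excess m := by
    have hocc_sum : ∑ i, occ i = ∑ m ∈ P.support, a m * d m := by
      rw [Finset.sum_comm]
      simp only [d, Finset.mul_sum]
    rw [hocc_sum, Finset.mul_sum, ← Finset.sum_add_distrib]
    refine Finset.sum_congr rfl fun m _ => ?_
    rw [hd, mul_left_comm, ← mul_add, Nat.add_sub_cancel' (two_mul_le_two_pow _)]
  have hzero : (0 : Fin n →₀ ℕ) ∈ P.support := by
    rw [MvPolynomial.mem_support_iff]
    intro h0
    exact hsol ⟨fun _ => 0, by rw [MvPolynomial.eval_zero', MvPolynomial.constantCoeff_eq, h0]⟩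
  have hexcess_zero : 1 ≤ excess 0 := by simpa [excess, d] using ha_pos 0 hzero
  have hocc_two (i : Fin n) : 2 ≤ occ i := by
    by_contra! hlt
    have hpos : occ i ≠ 0 := by
      intro h0
      obtain ⟨m, hm, hmi⟩ := hocc i
      have := (Finset.sum_eq_zero_iff.mp h0) m hm
      have := ha_pos m hm
      simp_all
    obtain ⟨m, -, hm1, hm'⟩ := exists_eq_one_of_sum_eq_one (show occ i = 1 by omega)
    obtain ⟨ham, hmi⟩ := mul_eq_one.mp hm1
    refine hsol (exists_eval_eq_zero_of_isolated_monomial P i ∅ (by simp) m ham hmi (by simp) ?_)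
    intro m' hm's hne hm'i
    have := ha_pos m' hm's
    rcases Nat.mul_eq_zero.mp (hm' m' hm's hne) with h0 | h0 <;> omega
  have hocc_sum : 2 * n ≤ ∑ i, occ i := by
    simpa [mul_comm] using Finset.card_nsmul_le_sum Finset.univ occ 2 fun i _ => hocc_two i
  have hexcess_le (s : Finset (Fin n →₀ ℕ)) (hs : s ⊆ P.support) :
      ∑ m ∈ s, excess m ≤ ∑ m ∈ P.support, excess m := Finset.sum_le_sum_of_subset hs
  rcases h with h | ⟨hdeg, h⟩
  · have := hexcess_le {0} (by simpa using hzero)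
    rw [Finset.sum_singleton] at this
    omega
  obtain ⟨k, hk, hdk⟩ : ∃ k ∈ P.support, 3 ≤ d k := by
    by_contra! hlt
    have : P.totalDegree ≤ 2 := Finset.sup_le fun m hm => by
      rw [hd]
      exact Nat.le_of_lt_succ (hlt m hm)
    omega
  have hne_zero {m : Fin n →₀ ℕ} (hm : 3 ≤ d m) : 0 ≠ m := by
    rintro rfl
    simp [d] at hm
  have hexcess_two {m} (hm : m ∈ P.support) (hdm : 3 ≤ d m) : 2 * a m ≤ excess m := by
    rw [mul_comm]
    refine Nat.mul_le_mul_left _ ?_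
    rcases hdm.eq_or_lt with h3 | h4
    · rw [← h3]
      norm_num
    · have := eight_le_two_pow_sub h4
      omega
  have hpair := hexcess_le {0, k} (by simp [Finset.insert_subset_iff, hzero, hk])
  rw [Finset.sum_pair (hne_zero hdk)] at hpair
  have hexcess_k := hexcess_two hk hdk
  have hak_pos := ha_pos k hk
  have hak : a k = 1 := by omega
  have hdk3 : d k = 3 := by
    by_contra hne
    have h8 := eight_le_two_pow_sub (show 4 ≤ d k by omega)
    have : excess k = 2 ^ d k - 2 * d k := by simp [excess, hak]
    omega
  have hdeg_two (m) (hm : m ∈ P.support) (hmk : m ≠ k) : d m ≤ 2 := by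
    by_contra! hdm
    have htriple := hexcess_le {0, k, m} (by simp [Finset.insert_subset_iff, hzero, hk, hm])
    rw [Finset.sum_insert (by simp [hne_zero hdk, hne_zero hdm]),
      Finset.sum_pair hmk.symm] at htriple
    have := hexcess_two hm hdm
    have := ha_pos m hm
    omega
  have hocc_eq (i : Fin n) : occ i = 2 := by
    have hsum : ∑ j, occ j = ∑ _j : Fin n, 2 := by
      simp only [Finset.sum_const, Finset.card_univ, Fintype.card_fin, smul_eq_mul]
      omega
    exact ((Finset.sum_eq_sum_iff_of_le fun j _ => hocc_two j).mp hsum.symm i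
      (Finset.mem_univ i)).symm
  have hocc_split (i : Fin n) : k i + ∑ m ∈ P.support.erase k, a m * m i = 2 := by
    have := Finset.add_sum_erase P.support (fun m => a m * m i) hk
    rw [hak, one_mul] at this
    exact this.trans (hocc_eq i)
  obtain ⟨i, hki⟩ : ∃ i, k i = 1 := by
    by_contra! hne
    have : 2 ∣ d k := Finset.dvd_sum fun i _ => by
      have := hocc_split i
      have := hne i
      omega
    omega
  obtain ⟨m, hm, ham, hm'⟩ := exists_eq_one_of_sum_eq_one
    (show ∑ m ∈ P.support.erase k, a m * m i = 1 by have := hocc_split i; omega)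
  obtain ⟨ham, hmi⟩ := mul_eq_one.mp ham
  obtain ⟨hmk, hms⟩ := Finset.mem_erase.mp hm
  obtain ⟨y, -, hy⟩ := Finset.exists_lt_of_sum_lt
    (show d m < d k by have := hdeg_two m hms hmk; omega)
  have hmy : m y = 0 := by
    have hle := Finset.single_le_sum (f := fun m => a m * m y) (fun _ _ => Nat.zero_le _) hm
    have := hocc_split y
    simp only [ham, one_mul] at hle
    omega
  have hiy : i ≠ y := by
    rintro rfl
    omega
  refine hsol (exists_eval_eq_zero_of_isolated_monomial P i {y} (by simpa using hiy) m ham hmi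
    (by simpa using hmy) ?_)
  intro m' hm's hne hm'i
  refine ⟨y, Finset.mem_singleton_self y, ?_⟩
  by_cases hm'k : m' = k
  · rw [hm'k]
    omega
  · have := ha_pos m' hm's
    rcases Nat.mul_eq_zero.mp (hm' m' (Finset.mem_erase.mpr ⟨hm'k, hm's⟩) hne) with h0 | h0 <;>
      omega
end

section
/- Let a, b, c be integers with gcd(a, b, c) = 1, let D = b² − 4ac, and let p be an odd prime not dividing D such that D is not a quadratic residue modulo p (i.e., there is no integer z with z² ≡ D (mod p)). Then for any integers x and y with a·x² + b·x·y + c·y² ≠ 0, the prime p appears with even multiplicity in the prime factorization of a·x² + b·x·y + c·y² (i.e., the p-adic valuation of a·x² + b·x·y + c·y² is even). -/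
/-- If the discriminant of a binary quadratic form is not a square modulo `p`, then the form
is anisotropic modulo `p`. -/
theorem dvd_and_dvd_of_dvd_binary_form {a b c : ℤ} {p : ℕ} (hp : p.Prime)
    (hnres : ¬ ∃ z : ℤ, (p : ℤ) ∣ z ^ 2 - (b ^ 2 - 4 * a * c)) {x y : ℤ}
    (hdvd : (p : ℤ) ∣ a * x ^ 2 + b * x * y + c * y ^ 2) : (p : ℤ) ∣ x ∧ (p : ℤ) ∣ y := by
  have hp' : Prime (p : ℤ) := Nat.prime_iff_prime_int.mp hp
  have ha : ¬ (p : ℤ) ∣ a := fun ⟨k, hk⟩ => hnres ⟨b, 4 * k * c, by rw [hk]; ring⟩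
  have hy : (p : ℤ) ∣ y := by
    by_contra hy
    obtain ⟨u, v, huv⟩ := (hp'.coprime_iff_not_dvd (n := y)).mpr hy
    obtain ⟨k, hk⟩ := hdvd
    refine hnres ⟨(2 * a * x + b * y) * v,
      4 * a * k * v ^ 2 - (b ^ 2 - 4 * a * c) * u * (1 + v * y), ?_⟩
    linear_combination 4 * a * v ^ 2 * hk + (b ^ 2 - 4 * a * c) * (1 + v * y) * huv
  have hx : (p : ℤ) ∣ a * x ^ 2 := by
    have hrest : (p : ℤ) ∣ y * (b * x + c * y) := hy.mul_right _
    rwa [show a * x ^ 2 + b * x * y + c * y ^ 2 = a * x ^ 2 + y * (b * x + c * y) by ring,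
      dvd_add_left hrest] at hdvd
  exact ⟨hp'.dvd_of_dvd_pow ((hp'.dvd_or_dvd hx).resolve_left ha), hy⟩

/-- If gcd(a,b,c) = 1, D = b² − 4ac, and p is an odd prime not dividing D such
that D is not a quadratic residue mod p, then p appears with even multiplicity
in the prime factorization of any nonzero value a·x² + b·x·y + c·y². -/
theorem even_multiplicity_of_nonresidue_prime (a b c : ℤ)
    (h : Int.gcd a (Int.gcd b c) = 1) (D : ℤ) (hD : D = b ^ 2 - 4 * a * c)
    (p : ℕ) (hp : p.Prime) (hodd : Odd p) (hpD : ¬ (p : ℤ) ∣ D)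
    (hnres : ¬ ∃ z : ℤ, (p : ℤ) ∣ z ^ 2 - D) (x y : ℤ)
    (hne : a * x ^ 2 + b * x * y + c * y ^ 2 ≠ 0) :
    Even ((a * x ^ 2 + b * x * y + c * y ^ 2).natAbs.factorization p) := by
  subst hD
  induction hn : (a * x ^ 2 + b * x * y + c * y ^ 2).natAbs using Nat.strong_induction_on
    generalizing x y with
  | _ n ih =>
    by_cases hdvd : (p : ℤ) ∣ a * x ^ 2 + b * x * y + c * y ^ 2
    · obtain ⟨⟨s, rfl⟩, ⟨t, rfl⟩⟩ := dvd_and_dvd_of_dvd_binary_form hp hnres hdvd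
      have hfactor : a * (p * s) ^ 2 + b * (p * s) * (p * t) + c * (p * t) ^ 2 =
          (p : ℤ) ^ 2 * (a * s ^ 2 + b * s * t + c * t ^ 2) := by ring
      rw [hfactor] at hne hn
      have hne' := right_ne_zero_of_mul hne
      have hpos := Int.natAbs_pos.mpr hne'
      rw [Int.natAbs_mul, Int.natAbs_pow, Int.natAbs_natCast] at hn
      have hlt : (a * s ^ 2 + b * s * t + c * t ^ 2).natAbs < n := by
        rw [← hn]
        exact lt_mul_of_one_lt_left hpos (Nat.one_lt_pow two_ne_zero hp.one_lt)
      rw [← hn, Nat.factorization_mul (pow_ne_zero 2 hp.ne_zero) hpos.ne', Finsupp.add_apply,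
        hp.factorization_pow, Finsupp.single_eq_same]
      exact even_two.add (ih _ hlt s t hne' rfl)
    · rw [← hn, Nat.factorization_eq_zero_of_not_dvd (mt Int.natCast_dvd.mpr hdvd)]
      exact Even.zero
end

section
/- The Diophantine equation 2 + x³·y + y² + z² = 0 has no integer solutions; that is, there are no integers x, y, z such that 2 + x³·y + y² + z² = 0. -/
/-- A nonzero factor of a sum of two squares that is coprime to its cofactor is itself a sum of two
squares. -/
theorem Nat.Coprime.eq_sq_add_sq_of_mul {a b u v : ℕ} (hab : a.Coprime b) (ha : a ≠ 0)
    (hb : b ≠ 0) (h : a * b = u ^ 2 + v ^ 2) : ∃ s t : ℕ, a = s ^ 2 + t ^ 2 := by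
  rw [Nat.eq_sq_add_sq_iff]
  intro q hq hq4
  have hqp : q.Prime := Nat.prime_of_mem_primeFactors hq
  have : Fact q.Prime := ⟨hqp⟩
  have hqa : q ∣ a := Nat.dvd_of_mem_primeFactors hq
  have hqb : ¬ q ∣ b := fun hqb => Nat.not_coprime_of_dvd_of_dvd hqp.one_lt hqa hqb hab
  have heven := Nat.eq_sq_add_sq_iff.mp ⟨u, v, h⟩ q
    (Nat.mem_primeFactors.mpr ⟨hqp, hqa.mul_right b, mul_ne_zero ha hb⟩) hq4
  rwa [padicValNat.mul ha hb, padicValNat.eq_zero_of_not_dvd hqb, add_zero] at heven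

/-- For odd `x`, the two factors of `x ^ 6 - 8` are coprime. -/
theorem Int.isCoprime_factors_pow_six_sub_eight {x : ℤ} (hx : Odd x) :
    IsCoprime (x ^ 2 - 2) (x ^ 4 + 2 * x ^ 2 + 4) := by
  have h2 : IsCoprime (x ^ 2 - 2) 2 := by
    obtain ⟨k, rfl⟩ := hx
    exact ⟨1, -(2 * k ^ 2 + 2 * k - 1), by ring⟩
  have h3 : IsCoprime (x ^ 2 - 2) 3 := by
    rw [isCoprime_comm, Int.prime_three.coprime_iff_not_dvd]
    intro h
    have hm : x % 3 = 0 ∨ x % 3 = 1 ∨ x % 3 = 2 := by omega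
    have h0 := Int.emod_eq_zero_of_dvd h
    rcases hm with hm | hm | hm <;> simp [pow_two, Int.sub_emod, Int.mul_emod, hm] at h0
  have h12 : IsCoprime (x ^ 2 - 2) (2 * 2 * 3) := (h2.mul_right h2).mul_right h3
  have h := h12.add_mul_left_right (x ^ 2 + 4)
  rwa [show 2 * 2 * 3 + (x ^ 2 - 2) * (x ^ 2 + 4) = x ^ 4 + 2 * x ^ 2 + 4 by ring] at h

theorem Int.sq_add_sq_emod_four_ne_three (s t : ℤ) : (s ^ 2 + t ^ 2) % 4 ≠ 3 := by
  rcases Int.even_or_odd' s with ⟨i, rfl | rfl⟩ <;>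
    rcases Int.even_or_odd' t with ⟨j, rfl | rfl⟩ <;> ring_nf <;> omega

/-- For odd `x`, the number `x ^ 6 - 8` is not a sum of two squares. -/
theorem Int.pow_six_sub_eight_ne_sq_add_sq {x : ℤ} (hx : Odd x) (u v : ℤ) :
    x ^ 6 - 8 ≠ u ^ 2 + v ^ 2 := by
  intro h
  have hfac : (x ^ 2 - 2) * (x ^ 4 + 2 * x ^ 2 + 4) = u ^ 2 + v ^ 2 := by rw [← h]; ring
  have hbpos : 0 < x ^ 4 + 2 * x ^ 2 + 4 := by positivity
  have hmod : (x ^ 2 - 2) % 4 = 3 := by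
    obtain ⟨k, rfl⟩ := hx
    ring_nf
    omega
  have hapos : 0 < x ^ 2 - 2 := by
    have : 0 ≤ x ^ 2 - 2 := nonneg_of_mul_nonneg_left (hfac ▸ by positivity) hbpos
    omega
  have hcop : (x ^ 2 - 2).natAbs.Coprime (x ^ 4 + 2 * x ^ 2 + 4).natAbs :=
    Int.isCoprime_iff_gcd_eq_one.mp (Int.isCoprime_factors_pow_six_sub_eight hx)
  obtain ⟨s, t, hst⟩ := Nat.Coprime.eq_sq_add_sq_of_mul (u := u.natAbs) (v := v.natAbs) hcop
    (Int.natAbs_ne_zero.mpr hapos.ne') (Int.natAbs_ne_zero.mpr hbpos.ne') (by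
      zify
      rw [abs_of_pos hapos, abs_of_pos hbpos, sq_abs, sq_abs, hfac])
  zify at hst
  rw [abs_of_pos hapos] at hst
  exact Int.sq_add_sq_emod_four_ne_three s t (hst ▸ hmod)

/-- The Diophantine equation 2 + x³·y + y² + z² = 0 has no integer solutions. -/
theorem no_solutions_h26 :
    ¬ ∃ x y z : ℤ, 2 + x ^ 3 * y + y ^ 2 + z ^ 2 = 0 := by
  rintro ⟨x, y, z, h⟩
  rcases Int.even_or_odd x with hx | hx
  · obtain ⟨k, rfl⟩ := hx.two_dvd
    rcases Int.even_or_odd' y with ⟨i, rfl | rfl⟩ <;>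
      rcases Int.even_or_odd' z with ⟨j, rfl | rfl⟩
    · ring_nf at h
      omega
    · ring_nf at h
      omega
    · ring_nf at h
      omega
    · obtain ⟨m, hm⟩ := Int.even_mul_succ_self i
      obtain ⟨n, hn⟩ := Int.even_mul_succ_self j
      ring_nf at h hm hn
      omega
  · exact Int.pow_six_sub_eight_ne_sq_add_sq hx (2 * y + x ^ 3) (2 * z) (by linear_combination -4 * h)
end

section
/- The Diophantine equation 1 + x³·y + 2y² + z² = 0 has no integer solutions; that is, there are no integers x, y, z such that 1 + x³·y + 2y² + z² = 0. -/
/-- An odd natural number dividing `a² + 2b²` with a coprime cofactor is `1` or `3` modulo `8`. -/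
theorem mod_eight_of_mul_eq_sq_add_two_mul_sq (A : ℕ) (B a b : ℤ) (hA : Odd A)
    (hAB : IsCoprime (A : ℤ) B) (h : (A : ℤ) * B = a ^ 2 + 2 * b ^ 2) :
    A % 8 = 1 ∨ A % 8 = 3 := by
  induction A using Nat.strong_induction_on generalizing a b with
  | _ A ih =>
    by_cases hc : a.gcd A = 1
    · have hmod : (-2 * b ^ 2) % (A : ℤ) = a ^ 2 % (A : ℤ) :=
        Int.modEq_iff_dvd.2 ⟨B, by linear_combination -h⟩
      have hJ : jacobiSym (-2) A * jacobiSym b A ^ 2 = 1 := by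
        rw [← jacobiSym.pow_left, ← jacobiSym.mul_left, jacobiSym.mod_left' hmod,
          jacobiSym.sq_one' hc]
      rw [jacobiSym.at_neg_two hA, ZMod.χ₈'_nat_eq_if_mod_eight] at hJ
      split_ifs at hJ with h₁ h₂
      · simp at hJ
      · exact h₂
      · nlinarith [sq_nonneg (jacobiSym b A)]
    · obtain ⟨p, hp, hpg⟩ := Nat.exists_prime_and_dvd hc
      have hpa : (p : ℤ) ∣ a := (Int.natCast_dvd_natCast.2 hpg).trans (Int.gcd_dvd_left ..)
      have hpA : p ∣ A :=
        Int.natCast_dvd_natCast.1 ((Int.natCast_dvd_natCast.2 hpg).trans (Int.gcd_dvd_right ..))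
      have hpodd : Odd p := hA.of_dvd_nat hpA
      have hpZ : Prime (p : ℤ) := Nat.prime_iff_prime_int.1 hp
      have hp2 : ¬ (p : ℤ) ∣ 2 := fun hd ↦ by
        have h2 : p = 2 := (Nat.prime_dvd_prime_iff_eq hp Nat.prime_two).1 (by exact_mod_cast hd)
        exact absurd hpodd (by rw [h2]; decide)
      have hpb : (p : ℤ) ∣ b := by
        have hd : (p : ℤ) ∣ 2 * b ^ 2 :=
          (Int.dvd_add_right (dvd_pow hpa two_ne_zero)).1
            (h ▸ (Int.natCast_dvd_natCast.2 hpA).mul_right B)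
        exact hpZ.dvd_of_dvd_pow ((hpZ.dvd_or_dvd hd).resolve_left hp2)
      obtain ⟨a', rfl⟩ := hpa
      obtain ⟨b', rfl⟩ := hpb
      have hpB : IsCoprime ((p : ℤ) ^ 2) B :=
        (hAB.of_isCoprime_of_dvd_left (Int.natCast_dvd_natCast.2 hpA)).pow_left
      have hd : (p : ℤ) ^ 2 ∣ A :=
        hpB.dvd_of_dvd_mul_right ⟨a' ^ 2 + 2 * b' ^ 2, by rw [h]; ring⟩
      obtain ⟨A', rfl⟩ : p ^ 2 ∣ A := by exact_mod_cast hd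
      push_cast at h hAB
      have hA' : Odd A' := (Nat.odd_mul.1 hA).2
      have hlt : A' < p ^ 2 * A' :=
        lt_mul_left hA'.pos (Nat.one_lt_pow two_ne_zero hp.one_lt)
      have key := ih A' hlt a' b' hA' hAB.of_mul_left_right
        (mul_left_cancel₀ (pow_ne_zero 2 hpZ.ne_zero) (by linear_combination h))
      have hsq : p ^ 2 % 8 = 1 := by
        have := Nat.eight_dvd_sq_sub_one_of_odd hpodd
        have := pow_pos hp.pos 2
        omega
      rw [Nat.mul_mod, hsq]
      omega

/-- The Diophantine equation 1 + x³·y + 2y² + z² = 0 has no integer solutions. -/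
theorem no_solutions_h29_savin :
    ¬ ∃ x y z : ℤ, 1 + x ^ 3 * y + 2 * y ^ 2 + z ^ 2 = 0 := by
  rintro ⟨x, y, z, h⟩
  rcases Int.even_or_odd x with ⟨k, rfl⟩ | hx
  · have h8 : 1 + 2 * y ^ 2 + z ^ 2 ≡ 0 [ZMOD 8] :=
      Int.modEq_zero_iff_dvd.2 ⟨-(k ^ 3 * y), by linear_combination h⟩
    replace h8 := (ZMod.intCast_eq_intCast_iff _ _ 8).2 h8
    push_cast at h8
    generalize (y : ZMod 8) = u at h8
    generalize (z : ZMod 8) = v at h8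
    revert u v
    decide
  · have hx8 := Int.eight_dvd_sq_sub_one_of_odd hx
    have hid : (x ^ 2 - 2) * (x ^ 4 + 2 * x ^ 2 + 4) = (x ^ 3 + 4 * y) ^ 2 + 2 * (2 * z) ^ 2 := by
      linear_combination -8 * h
    have hpos : 0 ≤ x ^ 2 - 2 := by
      by_contra! hneg
      nlinarith [sq_nonneg (x ^ 3 + 4 * y), sq_nonneg z, sq_nonneg (x ^ 2), sq_nonneg x]
    have h12 : (12 : ℤ) ∣ (x ^ 2 - 2) ^ 2 - 1 := by
      have h4 : (4 : ℤ) ∣ (x ^ 2 - 2) ^ 2 - 1 := by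
        rw [show (x ^ 2 - 2) ^ 2 - 1 = (x ^ 2 - 1) * (x ^ 2 - 3) by ring]
        exact Dvd.dvd.mul_right (by omega) _
      have h3 : (3 : ℤ) ∣ (x ^ 2 - 2) ^ 2 - 1 := by
        rw [← Nat.cast_ofNat, ← ZMod.intCast_zmod_eq_zero_iff_dvd]
        push_cast
        generalize (x : ZMod 3) = u
        revert u
        decide
      omega
    have hcop : IsCoprime (x ^ 2 - 2) (x ^ 4 + 2 * x ^ 2 + 4) := by
      obtain ⟨k, hk⟩ := h12
      exact ⟨x ^ 2 - 2 + k * (x ^ 2 + 4), -k, by linear_combination hk⟩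
    obtain ⟨A, hA⟩ := Int.eq_ofNat_of_zero_le hpos
    rw [hA] at hid hcop
    have := mod_eight_of_mul_eq_sq_add_two_mul_sq A _ _ _ (Nat.odd_iff.2 (by omega)) hcop hid
    omega
end

section
/- The Diophantine equation y·(x² − z² − y + 1) = x² + 3 has no integer solutions; that is, there are no integers x, y, z such that y·(x² − z² − y + 1) = x² + 3. Equivalently, the equation 3 + x² + y + x²·y + y² − y·z² = 0 has no integer solutions. -/
/-- An odd natural number dividing `x ^ 2 + 3` is not congruent to `2` modulo `3`. -/
theorem mod_three_ne_two_of_odd_of_dvd_sq_add_three {d : ℕ} {x : ℤ} (hd : d % 2 = 1)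
    (h : (d : ℤ) ∣ x ^ 2 + 3) : d % 3 ≠ 2 := by
  intro h3
  have hcop : x.gcd d = 1 := by
    have hx : ((x.gcd d : ℕ) : ℤ) ∣ 3 := by
      have h1 : ((x.gcd d : ℕ) : ℤ) ∣ x ^ 2 :=
        (Int.gcd_dvd_left x d).trans (dvd_pow_self x two_ne_zero)
      exact (dvd_add_right h1).1 ((Int.gcd_dvd_right x d).trans h)
    have hx' : x.gcd d ∣ 3 := by exact_mod_cast hx
    rcases (Nat.dvd_prime Nat.prime_three).1 hx' with h1 | h1
    · exact h1
    · have h2 : ((x.gcd d : ℕ) : ℤ) ∣ d := Int.gcd_dvd_right x d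
      rw [h1] at h2
      omega
  have hsq : jacobiSym (-3) d = 1 := by
    rw [← jacobiSym.sq_one' hcop]
    refine jacobiSym.mod_left' ?_
    exact (Int.modEq_iff_dvd.2 (by simpa using h) : -3 ≡ x ^ 2 [ZMOD d])
  have hthree : jacobiSym d 3 = -1 := by
    rw [jacobiSym.mod_left, show ((d : ℤ) % (3 : ℕ)) = 2 by omega]
    norm_num
  have hneg : jacobiSym (-3) d = ZMod.χ₄ d * jacobiSym 3 d :=
    jacobiSym.neg 3 (Nat.odd_iff.2 hd)
  rcases Nat.odd_mod_four_iff.1 hd with h4 | h4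
  · have := jacobiSym.quadratic_reciprocity_one_mod_four h4 (b := 3) (by decide)
    rw [ZMod.χ₄_nat_one_mod_four h4] at hneg
    push_cast at this
    omega
  · have := jacobiSym.quadratic_reciprocity_three_mod_four (a := 3) (b := d) (by decide) h4
    rw [ZMod.χ₄_nat_three_mod_four h4] at hneg
    push_cast at this
    omega

/-- A positive divisor of `x ^ 2 + 3` that is odd or congruent to `4` modulo `8` is not congruent
to `2` modulo `3`. -/
theorem emod_three_ne_two_of_dvd_sq_add_three {d x : ℤ} (hpos : 0 < d)
    (hd : d % 2 = 1 ∨ d % 8 = 4) (h : d ∣ x ^ 2 + 3) : d % 3 ≠ 2 := by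
  rcases hd with hd | hd
  · lift d to ℕ using hpos.le
    have := mod_three_ne_two_of_odd_of_dvd_sq_add_three (by omega) h
    omega
  · obtain ⟨e, rfl⟩ : (4 : ℤ) ∣ d := by omega
    lift e to ℕ using by omega
    have := mod_three_ne_two_of_odd_of_dvd_sq_add_three (d := e) (by omega)
      ((dvd_mul_left _ _).trans h)
    omega

theorem not_nine_dvd_sq_add_three (x : ℤ) : ¬ (9 : ℤ) ∣ x ^ 2 + 3 := by
  intro h
  have h1 : (x ^ 2 + 3) % 9 = 0 := Int.emod_eq_zero_of_dvd h
  have hx : x % 9 = 0 ∨ x % 9 = 1 ∨ x % 9 = 2 ∨ x % 9 = 3 ∨ x % 9 = 4 ∨ x % 9 = 5 ∨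
      x % 9 = 6 ∨ x % 9 = 7 ∨ x % 9 = 8 := by omega
  rcases hx with hx | hx | hx | hx | hx | hx | hx | hx | hx <;>
    simp [pow_two, Int.add_emod, Int.mul_emod, hx] at h1

theorem sq_add_three_emod_eight (x : ℤ) :
    (x ^ 2 + 3) % 8 = 3 ∨ (x ^ 2 + 3) % 8 = 4 ∨ (x ^ 2 + 3) % 8 = 7 := by
  have hx : x % 8 = 0 ∨ x % 8 = 1 ∨ x % 8 = 2 ∨ x % 8 = 3 ∨ x % 8 = 4 ∨ x % 8 = 5 ∨
      x % 8 = 6 ∨ x % 8 = 7 := by omega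
  rcases hx with hx | hx | hx | hx | hx | hx | hx | hx <;>
    simp [pow_two, Int.add_emod, Int.mul_emod, hx]

/-- If `y * t` and `(y - 1) * (t - 1)` are both of the form `a ^ 2 + 3`, then one of `y`, `t` is
`4` and the other `5` modulo `8`. -/
theorem emod_eight_of_mul_eq_sq_add_three {x y z t : ℤ} (h1 : y * t = x ^ 2 + 3)
    (h2 : (y - 1) * (t - 1) = z ^ 2 + 3) :
    (y % 8 = 4 ∧ t % 8 = 5) ∨ (y % 8 = 5 ∧ t % 8 = 4) := by
  have hx := sq_add_three_emod_eight x
  have hz := sq_add_three_emod_eight z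
  rw [← h1, Int.mul_emod] at hx
  rw [← h2, Int.mul_emod, Int.sub_emod y, Int.sub_emod t] at hz
  have hy0 := Int.emod_nonneg y (b := 8) (by norm_num)
  have hy8 := Int.emod_lt_of_pos y (b := 8) (by norm_num)
  have ht0 := Int.emod_nonneg t (b := 8) (by norm_num)
  have ht8 := Int.emod_lt_of_pos t (b := 8) (by norm_num)
  generalize y % 8 = a at *
  generalize t % 8 = b at *
  interval_cases a <;> interval_cases b <;> simp at hx hz ⊢

theorem sq_add_three_system_unsolvable {x y z t : ℤ} (h1 : y * t = x ^ 2 + 3)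
    (h2 : (y - 1) * (t - 1) = z ^ 2 + 3) : False := by
  have h8 := emod_eight_of_mul_eq_sq_add_three h1 h2
  have dy : y ∣ x ^ 2 + 3 := ⟨t, h1.symm⟩
  have dt : t ∣ x ^ 2 + 3 := ⟨y, by rw [← h1, mul_comm]⟩
  have dy' : y - 1 ∣ z ^ 2 + 3 := ⟨t - 1, h2.symm⟩
  have dt' : t - 1 ∣ z ^ 2 + 3 := ⟨y - 1, by rw [← h2, mul_comm]⟩
  have hyt : 0 < y * t := by rw [h1]; positivity
  rcases pos_and_pos_or_neg_and_neg_of_mul_pos hyt with ⟨hy, ht⟩ | ⟨hy, ht⟩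
  · have hyt' : 0 < (y - 1) * (t - 1) := by rw [h2]; positivity
    have hy1 : y ≠ 1 := by rintro rfl; simp at hyt'
    have ht1 : t ≠ 1 := by rintro rfl; simp at hyt'
    have a1 := emod_three_ne_two_of_dvd_sq_add_three hy (by omega) dy
    have a2 := emod_three_ne_two_of_dvd_sq_add_three ht (by omega) dt
    have a3 := emod_three_ne_two_of_dvd_sq_add_three (d := y - 1) (by omega) (by omega) dy'
    have a4 := emod_three_ne_two_of_dvd_sq_add_three (d := t - 1) (by omega) (by omega) dt'
    apply not_nine_dvd_sq_add_three z
    rw [← h2]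
    exact mul_dvd_mul (a := (3 : ℤ)) (c := 3) (by omega) (by omega)
  · have a1 := emod_three_ne_two_of_dvd_sq_add_three (d := -y) (by omega) (by omega)
      (neg_dvd.2 dy)
    have a2 := emod_three_ne_two_of_dvd_sq_add_three (d := -t) (by omega) (by omega)
      (neg_dvd.2 dt)
    have a3 := emod_three_ne_two_of_dvd_sq_add_three (d := -(y - 1)) (by omega) (by omega)
      (neg_dvd.2 dy')
    have a4 := emod_three_ne_two_of_dvd_sq_add_three (d := -(t - 1)) (by omega) (by omega)
      (neg_dvd.2 dt')
    apply not_nine_dvd_sq_add_three x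
    rw [← h1]
    exact mul_dvd_mul (a := (3 : ℤ)) (c := 3) (by omega) (by omega)

/-- The Diophantine equation y·(x² − z² − y + 1) = x² + 3 has no integer
solutions; equivalently, 3 + x² + y + x²·y + y² − y·z² = 0 has no integer
solutions. -/
theorem no_solutions_h29c :
    (¬ ∃ x y z : ℤ, y * (x ^ 2 - z ^ 2 - y + 1) = x ^ 2 + 3) ∧
    (¬ ∃ x y z : ℤ, 3 + x ^ 2 + y + x ^ 2 * y + y ^ 2 - y * z ^ 2 = 0) := by
  have key : ¬ ∃ x y z : ℤ, y * (x ^ 2 - z ^ 2 - y + 1) = x ^ 2 + 3 := by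
    rintro ⟨x, y, z, h⟩
    exact sq_add_three_system_unsolvable (z := z) h (by linear_combination h)
  refine ⟨key, ?_⟩
  rintro ⟨x, y, z, h⟩
  exact key ⟨x, -y, z, by linear_combination -h⟩
end

section
/- The Diophantine equation 3 − x² + x²·y + y² + y·z − y·z² = 0 has no integer solutions; that is, there are no integers x, y, z such that 3 − x² + x²·y + y² + y·z − y·z² = 0. -/
/-- The quadratic polynomial obtained from the equation by the substitution `z = x + w`. -/
def jumpForm (x y w : ℤ) : ℤ :=
  x ^ 2 + x * y * (2 * w - 1) + y * (w ^ 2 - w) - y ^ 2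

lemma jumpForm_neg (x y w : ℤ) : jumpForm (-x) y (1 - w) = jumpForm x y w := by
  unfold jumpForm; ring

lemma jumpForm_jump_x (x y w : ℤ) :
    jumpForm (-x - y * (2 * w - 1)) y w = jumpForm x y w := by
  unfold jumpForm; ring

lemma jumpForm_jump_y (x y w : ℤ) :
    jumpForm x (-y + x * (2 * w - 1) + (w ^ 2 - w)) w = jumpForm x y w := by
  unfold jumpForm; ring

lemma jumpForm_jump_w (x y w : ℤ) : jumpForm x y (1 - w - 2 * x) = jumpForm x y w := by
  unfold jumpForm; ring

lemma sq_sub_self_ne_four (w : ℤ) : w ^ 2 - w ≠ 4 := by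
  intro h
  have h1 : w ≤ 3 := by nlinarith
  have h2 : -3 ≤ w := by nlinarith
  interval_cases w <;> omega

lemma jumpForm_zero_ne (y w : ℤ) : jumpForm 0 y w ≠ 3 := by
  intro h
  unfold jumpForm at h
  have hd : y ∣ 3 := ⟨w ^ 2 - w - y, by linarith⟩
  have h1 := Int.le_of_dvd (by norm_num) hd
  have h2 := Int.le_of_dvd (by norm_num) (neg_dvd.mpr hd)
  have h0 : -3 ≤ y := by linarith
  have h3 := sq_sub_self_ne_four w
  have h4 : 0 ≤ w ^ 2 - w := by
    rcases le_or_gt w 0 with hw | hw <;> nlinarith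
  interval_cases y <;> omega

lemma jumpForm_one_ne (y w : ℤ) : jumpForm 1 y w ≠ 3 := by
  intro h
  unfold jumpForm at h
  have hd : y ∣ 2 := ⟨2 * w - 1 + (w ^ 2 - w) - y, by linarith⟩
  have h1 := Int.le_of_dvd (by norm_num) hd
  have h2 := Int.le_of_dvd (by norm_num) (neg_dvd.mpr hd)
  have h0 : -2 ≤ y := by linarith
  have h3 := sq_sub_self_ne_four (w + 1)
  have h4 : 0 ≤ (w + 1) ^ 2 - (w + 1) := by
    rcases le_or_gt w (-1) with hw | hw <;> nlinarith
  ring_nf at h3 h4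
  interval_cases y <;> omega

/-- Every solution with `2 ≤ x` admits a Vieta jump decreasing one coordinate. -/
lemma exists_jump_lt {x y w : ℤ} (hx : 2 ≤ x) (h : jumpForm x y w = 3) :
    |-x - y * (2 * w - 1)| < |x| ∨ |-y + x * (2 * w - 1) + (w ^ 2 - w)| < |y| ∨
      |2 * (1 - w - 2 * x) - 1| < |2 * w - 1| := by
  by_contra! hc
  obtain ⟨hcx, hcy, hcw⟩ := hc
  unfold jumpForm at h
  obtain ⟨v, hv⟩ : ∃ v, v = 2 * w - 1 := ⟨_, rfl⟩
  have hk : v ^ 2 = 4 * (w ^ 2 - w) + 1 := by rw [hv]; ring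
  have hk0 : 0 ≤ w ^ 2 - w := by
    rcases le_or_gt w 0 with hw | hw <;> nlinarith
  have hw' : 2 * (1 - w - 2 * x) - 1 = -v - 4 * x := by rw [hv]; ring
  rw [hw'] at hcw
  rw [← hv] at h hcx hcy hcw
  generalize w ^ 2 - w = k at *
  have hyx : y ^ 2 ≤ x ^ 2 - 3 := by
    have h1 : y * (-y + x * v + k) = -(x ^ 2 - 3) := by linarith
    have h2 := mul_le_mul_of_nonneg_left hcy (abs_nonneg y)
    rw [← abs_mul, ← abs_mul, h1, abs_neg, abs_of_nonneg (by nlinarith : 0 ≤ x ^ 2 - 3),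
      abs_mul_self] at h2
    linarith
  have hy0 : y ≠ 0 := by
    rintro rfl
    nlinarith
  have hv0 : v ≠ 0 := by omega
  rw [abs_of_pos (by linarith : 0 < x)] at hcx
  rcases lt_or_gt_of_ne hy0 with hy | hy <;> rcases lt_or_gt_of_ne hv0 with hv1 | hv1
  · have h1 : y * (v * (-v - 4 * x)) = 4 * (x ^ 2 - y ^ 2 - 3) - y := by
      linear_combination -4 * h - y * hk
    have h2 : v * (-v - 4 * x) < 0 := by
      by_contra! h3
      nlinarith [mul_nonneg_of_nonpos_of_nonpos hy.le (neg_nonpos.mpr h3)]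
    have h3 : 0 < -v - 4 * x := pos_of_mul_neg_right h2 hv1.le
    rw [abs_of_neg hv1, abs_of_pos h3] at hcw
    linarith
  · have h1 : x * (-x - y * v) < 0 := by nlinarith
    have h2 : -x - y * v < 0 := neg_of_mul_neg_right h1 (by linarith)
    rw [abs_of_neg h2] at hcx
    linarith [mul_neg_of_neg_of_pos hy hv1]
  · have h1 : 2 * x + y * v ≤ 0 := by
      have h2 := mul_neg_of_pos_of_neg hy hv1
      rcases le_abs.mp hcx with h3 | h3 <;> linarith
    have h2 : 0 ≤ 2 * x + v := by
      rw [abs_of_neg hv1] at hcw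
      rcases le_abs.mp hcw with h3 | h3 <;> linarith
    have h3 : x * v * (y - 1) ≤ 0 :=
      mul_nonpos_of_nonpos_of_nonneg (mul_neg_of_pos_of_neg (by linarith) hv1).le (by linarith)
    have h4 := mul_nonpos_of_nonneg_of_nonpos h2 h1
    nlinarith
  · nlinarith [mul_pos (mul_pos (by linarith : 0 < x) hy) hv1, mul_nonneg hy.le hk0]

lemma jumpForm_ne_three (x y w : ℤ) : jumpForm x y w ≠ 3 := by
  induction hn : x.natAbs + y.natAbs + (2 * w - 1).natAbs using Nat.strong_induction_on
    generalizing x y w with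
  | _ n ih =>
    wlog hx : 0 ≤ x generalizing x w
    · rw [← jumpForm_neg]
      exact this (-x) (1 - w) (by omega) (by omega)
    intro h
    rcases (by omega : x = 0 ∨ x = 1 ∨ 2 ≤ x) with rfl | rfl | hx2
    · exact jumpForm_zero_ne y w h
    · exact jumpForm_one_ne y w h
    · have hd := exists_jump_lt hx2 h
      simp only [Int.abs_eq_natAbs, Nat.cast_lt] at hd
      rcases hd with hj | hj | hj
      · exact ih _ (by omega) _ _ _ rfl ((jumpForm_jump_x x y w).trans h)
      · exact ih _ (by omega) _ _ _ rfl ((jumpForm_jump_y x y w).trans h)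
      · exact ih _ (by omega) _ _ _ rfl ((jumpForm_jump_w x y w).trans h)

/-- The Diophantine equation 3 − x² + x²·y + y² + y·z − y·z² = 0 has no
integer solutions. -/
theorem no_solutions_h31a :
    ¬ ∃ x y z : ℤ, 3 - x ^ 2 + x ^ 2 * y + y ^ 2 + y * z - y * z ^ 2 = 0 := by
  rintro ⟨x, y, z, h⟩
  refine jumpForm_ne_three x y (z - x) ?_
  unfold jumpForm
  linear_combination -h
end

section
/- The Diophantine equation 3 + x² + x²·y + 2y² − y·z² = 0 has no integer solutions; that is, there are no integers x, y, z such that 3 + x² + x²·y + 2y² − y·z² = 0. -/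
/-- Vieta jumping: a positive solution of `(a - s b)² + 2 w² + 12 = 2 a b w` with `s² = 1` yields
one that no jump makes smaller. -/
theorem exists_reduced_solution {s : ℤ} (hs : s ^ 2 = 1) (n : ℕ) :
    ∀ a b w : ℤ, 0 < a → 0 < b → 0 < w → a + b + w ≤ n →
      (a - s * b) ^ 2 + 2 * w ^ 2 + 12 = 2 * a * b * w →
      ∃ a b w : ℤ, 0 < b ∧ 0 < w ∧ b ≤ a ∧ 2 * w ≤ a * b ∧ a ≤ b * (w + s) ∧
        (a - s * b) ^ 2 + 2 * w ^ 2 + 12 = 2 * a * b * w := by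
  induction n with
  | zero => intro a b w ha hb hw hn; push_cast at hn; omega
  | succ n ih =>
    intro a b w ha hb hw hn h
    push_cast at hn
    wlog hab : b ≤ a generalizing a b
    · exact this b a hb ha (by linear_combination h + (a ^ 2 - b ^ 2) * hs) (by omega) (by omega)
    by_cases hjw : 2 * w ≤ a * b
    · by_cases hja : a ≤ b * (w + s)
      · exact ⟨a, b, w, hb, hw, hab, hjw, hja, h⟩
      · have hprod : a * (2 * b * (w + s) - a) = b ^ 2 + 2 * w ^ 2 + 12 := by
          linear_combination -h + b ^ 2 * hs
        refine ih (2 * b * (w + s) - a) b w (pos_of_mul_pos_right ?_ ha.le) hb hw (by linarith)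
          (by linear_combination h)
        rw [hprod]; positivity
    · have hprod : w * (2 * (a * b - w)) = (a - s * b) ^ 2 + 12 := by linear_combination -h
      have hpos : 0 < 2 * (a * b - w) := by
        refine pos_of_mul_pos_right ?_ hw.le
        rw [hprod]; positivity
      exact ih a b (a * b - w) ha hb (by linarith) (by linarith) (by linear_combination h)

/-- In a reduced solution, the quadratic in `a` is nonnegative at `b` and at `2 w / b`. -/
theorem reduced_solution_bounds {s a b w : ℤ} (hs : s ^ 2 = 1) (hb : 0 < b) (hab : b ≤ a)
    (hjw : 2 * w ≤ a * b) (hja : a ≤ b * (w + s))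
    (h : (a - s * b) ^ 2 + 2 * w ^ 2 + 12 = 2 * a * b * w) :
    b ^ 2 * (w + s - 1) ≤ w ^ 2 + 6 ∧
      2 * w ^ 2 * b ^ 2 ≤ (2 * w - s * b ^ 2) ^ 2 + 12 * b ^ 2 := by
  constructor
  · have := mul_nonneg (sub_nonneg.2 hab) (by linarith : 0 ≤ 2 * (b * (w + s)) - a - b)
    linarith [congrArg (b ^ 2 * ·) hs]
  · have h₁ : a * b ≤ b * (w + s) * b := mul_le_mul_of_nonneg_right hja hb.le
    have := mul_nonneg (sub_nonneg.2 hjw)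
      (by linarith : 0 ≤ 2 * (b * (w + s) * b) - a * b - 2 * w)
    linarith [congrArg (b ^ 2 * ·) h, congrArg (b ^ 4 * ·) hs]

theorem sub_sq_add_ne {a b w : ℤ} (ha : 0 < a) (hb : 0 < b) (hw : 0 < w) :
    (a - b) ^ 2 + 2 * w ^ 2 + 12 ≠ 2 * a * b * w := by
  intro h
  obtain ⟨a, b, w, hb, hw, hab, hjw, hja, h⟩ := exists_reduced_solution (s := 1) (by norm_num)
    (a + b + w).toNat a b w ha hb hw (Int.self_le_toNat _) (by linear_combination h)
  obtain ⟨hP, hQ⟩ := reduced_solution_bounds (by norm_num) hb hab hjw hja h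
  have hb2 : 2 ≤ b := by
    by_contra hlt
    obtain rfl : b = 1 := by omega
    nlinarith [sq_nonneg (a - 1 - w), sq_nonneg (w - 1)]
  have hB : b ^ 2 ≤ w + 6 := by
    refine le_of_mul_le_mul_right ?_ hw
    nlinarith
  have hB4 : 4 ≤ b ^ 2 := by nlinarith
  have hw3 : w ≤ 3 := by
    have : w ^ 2 + 3 * w ≤ 18 := by
      refine le_of_mul_le_mul_right ?_ (by positivity : 0 < b ^ 2)
      nlinarith [mul_le_mul_of_nonneg_left hB (sq_nonneg b),
        mul_le_mul_of_nonneg_left hB4 (sq_nonneg w)]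
    nlinarith
  have hb3 : b ≤ 3 := by nlinarith
  interval_cases w <;> interval_cases b <;> norm_num at hja <;> interval_cases a <;> omega

theorem add_sq_add_ne {a b w : ℤ} (ha : 0 < a) (hb : 0 < b) (hw : 0 < w) :
    (a + b) ^ 2 + 2 * w ^ 2 + 12 ≠ 2 * a * b * w := by
  intro h
  obtain ⟨a, b, w, hb, hw, hab, hjw, hja, h⟩ := exists_reduced_solution (s := -1) (by norm_num)
    (a + b + w).toNat a b w ha hb hw (Int.self_le_toNat _) (by linear_combination h)
  obtain ⟨hP, hQ⟩ := reduced_solution_bounds (by norm_num) hb hab hjw hja h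
  have hb2 : 2 ≤ b := by
    by_contra hlt
    obtain rfl : b = 1 := by omega
    nlinarith [sq_nonneg (a - w + 1)]
  have hw3 : 3 ≤ w := by
    by_contra hlt
    obtain rfl | rfl : w = 1 ∨ w = 2 := by omega
    · nlinarith
    · nlinarith [sq_nonneg (a - b)]
  have hB : b ^ 2 ≤ w + 12 := by
    refine le_of_mul_le_mul_right ?_ (by linarith : 0 < w - 2)
    nlinarith
  have hB4 : 4 ≤ b ^ 2 := by nlinarith
  have hw8 : w ≤ 8 := by
    have : w ^ 2 ≤ 5 * w + 24 := by
      refine le_of_mul_le_mul_right ?_ (by positivity : 0 < b ^ 2)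
      nlinarith [mul_le_mul_of_nonneg_left hB (sq_nonneg b),
        mul_le_mul_of_nonneg_left hB4 (sq_nonneg w)]
    nlinarith
  have hb4 : b ≤ 4 := by nlinarith
  interval_cases w <;> interval_cases b <;> norm_num at hja hP <;> interval_cases a <;> omega

/-- The Diophantine equation 3 + x² + x²·y + 2y² − y·z² = 0 has no integer
solutions. -/
theorem no_solutions_h31f :
    ¬ ∃ x y z : ℤ, 3 + x ^ 2 + x ^ 2 * y + 2 * y ^ 2 - y * z ^ 2 = 0 := by
  rintro ⟨x, y, z, h⟩
  have hprod : 0 < y * (z ^ 2 - x ^ 2) := by nlinarith [sq_nonneg x, sq_nonneg y]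
  have hx := sq_abs x
  have hz := sq_abs z
  rcases pos_and_pos_or_neg_and_neg_of_mul_pos hprod with ⟨hy, hd⟩ | ⟨hy, hd⟩
  · have hlt : |x| < |z| := sq_lt_sq.1 (by linarith)
    have hx0 := abs_nonneg x
    refine sub_sq_add_ne (a := |z| + |x|) (b := |z| - |x|) (w := 2 * y)
      (by linarith) (by linarith) (by linarith) ?_
    linear_combination 4 * h + (4 + 4 * y) * hx - 4 * y * hz
  · have hlt : |z| < |x| := sq_lt_sq.1 (by linarith)
    have hz0 := abs_nonneg z
    refine add_sq_add_ne (a := |x| + |z|) (b := |x| - |z|) (w := -(2 * y))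
      (by linarith) (by linarith) (by linarith) ?_
    linear_combination 4 * h + (4 + 4 * y) * hx - 4 * y * hz
end

section
/- Neither of the two Diophantine equations 12 + (u + v)² − 2·u·v·t + 2t² = 0 and 12 + (u − v)² − 2·u·v·t + 2t² = 0 has an integer solution; that is, there are no integers u, v, t satisfying either equation. -/
/-- The range of the small variable at a triple that Vieta jumping cannot shrink. -/
lemma le_three_of_reduced_bound {e v c : ℤ} (he : e = 1 ∨ e = -1) (hvc : v ≤ c)
    (h : 2 * c * v * (c - e) ≤ 3 * c ^ 2 + v ^ 2 + 12) : v ≤ 3 := by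
  by_contra! hv
  have h1 : v * (c * (2 * c - 3)) ≤ 3 * c ^ 2 + 12 := by
    rcases he with rfl | rfl <;> nlinarith
  nlinarith [mul_nonneg (by linarith : 0 ≤ v - 4)
    (mul_nonneg (by linarith : 0 ≤ c) (by linarith : 0 ≤ 2 * c - 3))]

/-- There is no positive solution that Vieta jumping in `u` or in `t` cannot shrink. -/
lemma no_reduced_solution {e u v t : ℤ} (he : e = 1 ∨ e = -1) (hv : 0 < v) (ht : 0 < t)
    (hvu : v ≤ u) (hu : u ≤ v * (t - e)) (htuv : 2 * t ≤ u * v)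
    (h : u ^ 2 + v ^ 2 + 2 * t ^ 2 + 12 = 2 * u * v * (t - e)) : False := by
  rcases le_or_gt t v with htv | htv
  · have hb : v ^ 2 * (t - e - 1) ≤ t ^ 2 + 6 := by
      nlinarith [mul_nonneg (by linarith : 0 ≤ u - v)
        (by linarith : 0 ≤ 2 * (v * (t - e)) - u - v)]
    have ht3 : t ≤ 3 := by
      by_contra! ht4
      have : v ^ 2 * 2 ≤ v ^ 2 * (t - e - 1) :=
        mul_le_mul_of_nonneg_left (by omega) (sq_nonneg v)
      nlinarith
    by_cases hs : t - e = 1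
    · rw [hs] at h
      nlinarith [sq_nonneg (u - v), sq_nonneg t]
    have hs2 : 2 ≤ t - e := by
      have : 0 < t - e := by
        by_contra! h0
        nlinarith
      omega
    have hv3 : v ≤ 3 := by
      by_contra! hv4
      rcases he with rfl | rfl <;> interval_cases t <;> first | omega | nlinarith
    rcases he with rfl | rfl <;> interval_cases t <;> interval_cases v <;>
      first | omega | (norm_num at hu; interval_cases u <;> omega)
  rcases le_or_gt t u with htu | htu
  · have hb : 2 * t * v * (t - e) ≤ 3 * t ^ 2 + v ^ 2 + 12 := by
      nlinarith [mul_nonneg (by linarith : 0 ≤ u - t)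
        (by linarith : 0 ≤ 2 * (v * (t - e)) - u - t)]
    have hv3 := le_three_of_reduced_bound he htv.le hb
    have hv2 : 2 ≤ v := by
      by_contra! hv1
      obtain rfl : v = 1 := by omega
      omega
    have ht6 : t ≤ 6 := by
      by_contra! ht7
      rcases he with rfl | rfl <;> interval_cases v <;> nlinarith
    rcases he with rfl | rfl <;> interval_cases v <;> interval_cases t <;>
      first | omega | (norm_num at hu; interval_cases u <;> omega)
  · have hb : 2 * u * v * (u - e) ≤ 3 * u ^ 2 + v ^ 2 + 12 := by
      nlinarith [mul_nonneg (by linarith : 0 ≤ t - u) (by linarith : 0 ≤ u * v - t - u)]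
    have hv3 := le_three_of_reduced_bound he hvu hb
    obtain rfl : v = 3 := by
      have : 2 < v := by
        by_contra! hv2
        nlinarith
      omega
    have hu3 : u ≤ 3 := by
      by_contra! hu4
      rcases he with rfl | rfl <;> nlinarith
    obtain rfl : u = 3 := by omega
    obtain rfl : t = 4 := by omega
    omega

/-- Vieta jumping: the equation has no positive solution. -/
lemma no_positive_solution {e : ℤ} (he : e = 1 ∨ e = -1) (n : ℕ) :
    ∀ u v t : ℤ, 0 < u → 0 < v → 0 < t → u + v + t ≤ n →
      u ^ 2 + v ^ 2 + 2 * t ^ 2 + 12 = 2 * u * v * (t - e) → False := by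
  induction n with
  | zero => intro u v t hu hv ht hn; omega
  | succ n ih =>
    intro u v t hu hv ht hn h
    wlog hvu : v ≤ u generalizing u v
    · exact this v u hv hu (by linarith) (by linarith) (by linarith)
    by_cases hjump : u ≤ v * (t - e)
    · by_cases hjump' : 2 * t ≤ u * v
      · exact no_reduced_solution he hv ht hvu hjump hjump' h
      · have hprod : 2 * (t * (u * v - t)) = (u + e * v) ^ 2 + 12 := by
          rcases he with rfl | rfl <;> linarith
        have hpos : 0 < u * v - t :=
          pos_of_mul_pos_right (by nlinarith [sq_nonneg (u + e * v)]) ht.le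
        push_cast at hn
        exact ih u v (u * v - t) hu hv hpos (by linarith) (by linarith)
    · have hprod : u * (2 * (v * (t - e)) - u) = v ^ 2 + 2 * t ^ 2 + 12 := by linarith
      have hpos : 0 < 2 * (v * (t - e)) - u :=
        pos_of_mul_pos_right (by rw [hprod]; positivity) hu.le
      push_cast at hn
      exact ih (2 * (v * (t - e)) - u) v t hpos hv ht (by linarith) (by linarith)

lemma no_solution {e : ℤ} (he : e = 1 ∨ e = -1) (u v t : ℤ) :
    12 + (u + e * v) ^ 2 - 2 * u * v * t + 2 * t ^ 2 ≠ 0 := by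
  intro h
  have hpos : 0 < u * v * t := by nlinarith [sq_nonneg (u + e * v), sq_nonneg t]
  have hu : u ≠ 0 := by rintro rfl; simp at hpos
  have hv : v ≠ 0 := by rintro rfl; simp at hpos
  have he2 : e ^ 2 = 1 := by rcases he with rfl | rfl <;> norm_num
  have h' : u ^ 2 + v ^ 2 + 2 * t ^ 2 + 12 = 2 * (u * v) * (t - e) := by
    linear_combination h - v ^ 2 * he2
  have hu' := abs_pos.mpr hu
  have hv' := abs_pos.mpr hv
  have ht' : t ≠ 0 := by rintro rfl; simp at hpos
  rcases lt_or_gt_of_ne (mul_ne_zero hu hv) with huv | huv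
  · have ht : 0 < -t := by
      have := neg_of_mul_pos_right hpos huv.le
      linarith
    refine no_positive_solution (e := -e) (by omega) (|u| + |v| + -t).toNat |u| |v| (-t)
      hu' hv' ht (Int.self_le_toNat _) ?_
    rw [sq_abs, sq_abs, mul_assoc 2, ← abs_mul, abs_of_neg huv]
    linarith
  · have ht : 0 < t := pos_of_mul_pos_right hpos huv.le
    refine no_positive_solution he (|u| + |v| + t).toNat |u| |v| t
      hu' hv' ht (Int.self_le_toNat _) ?_
    rw [sq_abs, sq_abs, mul_assoc 2, ← abs_mul, abs_of_pos huv]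
    linarith

/-- Neither of the equations 12 + (u ± v)² − 2·u·v·t + 2t² = 0 has an integer
solution. -/
theorem no_solutions_pair_equations :
    (¬ ∃ u v t : ℤ, 12 + (u + v) ^ 2 - 2 * u * v * t + 2 * t ^ 2 = 0) ∧
    (¬ ∃ u v t : ℤ, 12 + (u - v) ^ 2 - 2 * u * v * t + 2 * t ^ 2 = 0) := by
  constructor
  · rintro ⟨u, v, t, h⟩
    exact no_solution (Or.inl rfl) u v t (by linarith)
  · rintro ⟨u, v, t, h⟩
    exact no_solution (Or.inr rfl) u v t (by linarith)
end

section
/- The Diophantine equation x³ + x²·y² + y³ = 7 has no integer solutions; that is, there are no integers x, y such that x³ + x²·y² + y³ = 7. -/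
/-- With `a = -x`, `b = -y`: there are no solutions with both variables negative. -/
lemma sq_mul_sq_ne_of_pos_of_le {a b : ℤ} (hb : 1 ≤ b) (hba : b ≤ a) :
    a ^ 2 * b ^ 2 ≠ a ^ 3 + b ^ 3 + 7 := by
  intro h
  obtain ⟨k, hk⟩ : ∃ k, k = b ^ 2 - a := ⟨_, rfl⟩
  have hak : a ^ 2 * k = b ^ 3 + 7 := by rw [hk]; linarith
  have hk_pos : 0 < k := by
    have : 0 < b ^ 3 := by positivity
    by_contra! hk_nonpos
    nlinarith [sq_nonneg a]
  have hab : a = b ^ 2 - k := by omega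
  obtain hb_small | hb_large : b ≤ 2 ∨ 3 ≤ b := by omega
  · interval_cases b
    · omega
    · obtain rfl | rfl : a = 2 ∨ a = 3 := by omega
      all_goals omega
  obtain rfl | hk_two : k = 1 ∨ 2 ≤ k := by omega
  · subst hab
    have : 3 * b ^ 3 ≤ b ^ 4 := by
      nlinarith [pow_pos (show 0 < b by omega) 3]
    nlinarith [mul_nonneg (sub_nonneg.2 hb_large) (sq_nonneg b)]
  · have h1 : 2 * (b ^ 2 - 2) ≤ a * k := by
      nlinarith [mul_nonneg (show 0 ≤ a - 2 by omega) (sub_nonneg.2 hk_two)]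
    have h2 : b * (a * k) ≤ a * (a * k) :=
      mul_le_mul_of_nonneg_right hba (mul_nonneg (by omega) (by omega))
    have h3 : b * (2 * (b ^ 2 - 2)) ≤ b * (a * k) :=
      mul_le_mul_of_nonneg_left h1 (by omega)
    nlinarith [mul_nonneg (sub_nonneg.2 hb_large) (sq_nonneg b)]

/-- With `a = x`, `b = -y`: there are no solutions with variables of opposite sign. -/
lemma cube_add_sq_mul_sq_ne_of_pos {a b : ℤ} (ha : 1 ≤ a) (hb : 1 ≤ b) :
    a ^ 3 + a ^ 2 * b ^ 2 ≠ b ^ 3 + 7 := by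
  intro h
  have hbk : b ^ 2 * (b - a ^ 2) = a ^ 3 - 7 := by linarith
  have hb_sq : 0 < b ^ 2 := by positivity
  rcases lt_trichotomy (b - a ^ 2) 0 with hk | hk | hk
  · have ha_lt : a < 2 := by
      by_contra! ha_two
      nlinarith [pow_le_pow_left₀ (by norm_num) ha_two 3]
    obtain rfl : a = 1 := by omega
    omega
  · rw [hk, mul_zero] at hbk
    have ha_lt : a < 2 := by
      by_contra! ha_two
      nlinarith [pow_le_pow_left₀ (by norm_num) ha_two 3]
    obtain rfl : a = 1 := by omega
    omega
  · have h1 : (a ^ 2) ^ 2 ≤ b ^ 2 := pow_le_pow_left₀ (by positivity) (by omega) 2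
    have h2 : a ^ 3 ≤ a ^ 4 := pow_le_pow_right₀ ha (by norm_num)
    nlinarith

/-- The symmetric Diophantine equation x³ + x²·y² + y³ = 7 has no integer
solutions. -/
theorem no_solutions_h39_symmetric :
    ¬ ∃ x y : ℤ, x ^ 3 + x ^ 2 * y ^ 2 + y ^ 3 = 7 := by
  rintro ⟨x, y, h⟩
  have cube_ne (z : ℤ) : z ^ 3 ≠ 7 := by
    intro hz
    have h1 : 1 < z := by
      by_contra! hz_le
      nlinarith [mul_nonneg (sub_nonneg.2 hz_le) (show 0 ≤ z ^ 2 + z + 1 by nlinarith)]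
    nlinarith [pow_le_pow_left₀ (by norm_num) (show 2 ≤ z by omega) 3]
  rcases lt_trichotomy x 0 with hx | rfl | hx
  · rcases lt_trichotomy y 0 with hy | rfl | hy
    · rcases le_total x y with hxy | hxy
      · exact sq_mul_sq_ne_of_pos_of_le (a := -x) (b := -y) (by omega) (by omega)
          (by linarith)
      · exact sq_mul_sq_ne_of_pos_of_le (a := -y) (b := -x) (by omega) (by omega)
          (by linarith)
    · exact cube_ne x (by linarith)
    · exact cube_add_sq_mul_sq_ne_of_pos (a := y) (b := -x) (by omega) (by omega)
        (by linarith)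
  · exact cube_ne y (by linarith)
  · rcases lt_trichotomy y 0 with hy | rfl | hy
    · exact cube_add_sq_mul_sq_ne_of_pos (a := x) (b := -y) (by omega) (by omega)
        (by linarith)
    · exact cube_ne x (by linarith)
    · have hy_cube : 0 < y ^ 3 := by positivity
      have hx_cube : 0 < x ^ 3 := by positivity
      have hxy_sq : 0 < x ^ 2 * y ^ 2 := by positivity
      have hx_lt : x < 2 := by
        by_contra! hx_two
        nlinarith [pow_le_pow_left₀ (by norm_num) hx_two 3]
      have hy_lt : y < 2 := by
        by_contra! hy_two
        nlinarith [pow_le_pow_left₀ (by norm_num) hy_two 3]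
      obtain rfl : x = 1 := by omega
      obtain rfl : y = 1 := by omega
      norm_num at h
end

section
/- The Diophantine equation 5 + x³ + y² + x·y·z + z² = 0 has no integer solutions; that is, there are no integers x, y, z such that 5 + x³ + y² + x·y·z + z² = 0. -/
theorem jacobiSym_three_eq_neg_one {b : ℕ} (hb : b % 12 = 5 ∨ b % 12 = 7) :
    jacobiSym 3 b = -1 := by
  have hodd : Odd b := Nat.odd_iff.mpr (by omega)
  rw [jacobiSym.mod_right 3 hodd]
  norm_num
  rcases hb with h | h <;> rw [h] <;> norm_num

theorem not_dvd_three_sub_sq {n : ℤ} (hn : n % 12 = 5 ∨ n % 12 = 7) (w : ℤ) :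
    ¬ n ∣ 3 - w ^ 2 := by
  intro h
  refine ZMod.nonsquare_of_jacobiSym_eq_neg_one
    (jacobiSym_three_eq_neg_one (b := n.natAbs) (by omega)) ⟨(w : ZMod n.natAbs), ?_⟩
  have h0 : ((3 - w ^ 2 : ℤ) : ZMod n.natAbs) = 0 :=
    (ZMod.intCast_zmod_eq_zero_iff_dvd _ _).mpr (Int.natAbs_dvd.mpr h)
  push_cast at h0 ⊢
  linear_combination h0

theorem mod_four_of_eq_zero {x y z : ℤ} (h : 5 + x ^ 3 + y ^ 2 + x * y * z + z ^ 2 = 0) :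
    x % 4 = 3 := by
  have key : ∀ a b c : ZMod 4, 5 + a ^ 3 + b ^ 2 + a * b * c + c ^ 2 = 0 → a = 3 := by decide
  have hx := key x y z (by exact_mod_cast congrArg (Int.cast : ℤ → ZMod 4) h)
  exact (ZMod.intCast_eq_intCast_iff' x 3 4).mp (by exact_mod_cast hx)

set_option maxRecDepth 20000 in
theorem mod_nine_of_eq_zero {x y z : ℤ} (h : 5 + x ^ 3 + y ^ 2 + x * y * z + z ^ 2 = 0) :
    x % 3 = 0 ∨ x % 9 = 1 := by
  have key : ∀ a b c : ZMod 9, 5 + a ^ 3 + b ^ 2 + a * b * c + c ^ 2 = 0 →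
      a = 0 ∨ a = 1 ∨ a = 3 ∨ a = 6 := by decide
  have hx := key x y z (by exact_mod_cast congrArg (Int.cast : ℤ → ZMod 9) h)
  have cast_eq (k : ℤ) (hk : (x : ZMod 9) = (k : ZMod 9)) : x % 9 = k % 9 :=
    (ZMod.intCast_eq_intCast_iff' x k 9).mp hk
  rcases hx with hx | hx | hx | hx
  · have := cast_eq 0 (by exact_mod_cast hx); omega
  · have := cast_eq 1 (by exact_mod_cast hx); omega
  · have := cast_eq 3 (by exact_mod_cast hx); omega
  · have := cast_eq 6 (by exact_mod_cast hx); omega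

/-- The Diophantine equation 5 + x³ + y² + x·y·z + z² = 0 has no integer
solutions. -/
theorem no_solutions_h29_main :
    ¬ ∃ x y z : ℤ, 5 + x ^ 3 + y ^ 2 + x * y * z + z ^ 2 = 0 := by
  rintro ⟨x, y, z, h⟩
  have h4 := mod_four_of_eq_zero h
  have hdvd : x + 2 ∣ 3 - (y - z) ^ 2 :=
    ⟨4 - 2 * x + x ^ 2 + y * z, by linear_combination -h⟩
  rcases mod_nine_of_eq_zero h with h3 | h9
  · exact not_dvd_three_sub_sq (by omega) _ hdvd
  · obtain ⟨n, hn⟩ : (3 : ℤ) ∣ x + 2 := by omega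
    exact not_dvd_three_sub_sq (n := n) (by omega) _ ((Dvd.intro_left 3 hn.symm).trans hdvd)
end

section
/- Let a and b be nonzero integers, let n ≥ 1, and let k₁, …, kₙ be positive integers. Then there exist integers x₁, …, xₙ with a·x₁^{k₁}·…·xₙ^{kₙ} = b if and only if all of the following hold: a divides b; either b/a > 0 or at least one kᵢ is odd; and for every prime p, the p-adic valuation of |b/a| can be written as Σᵢ cᵢ·kᵢ for some nonnegative integers c₁, …, cₙ (i.e., it lies in the additive submonoid of the natural numbers generated by k₁, …, kₙ). -/
theorem Nat.exists_prod_pow_eq_iff {ι : Type*} [Fintype ι] (k : ι → ℕ) {m : ℕ} (hm : m ≠ 0) :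
    (∃ y : ι → ℕ, ∏ i, y i ^ k i = m) ↔
      ∀ p : ℕ, p.Prime → ∃ c : ι → ℕ, m.factorization p = ∑ i, c i * k i := by
  constructor
  · rintro ⟨y, rfl⟩ p -
    refine ⟨fun i => (y i).factorization p, ?_⟩
    rw [Nat.factorization_prod (Finset.prod_ne_zero_iff.mp hm), Finsupp.finsetSum_apply]
    simp [Nat.factorization_pow, mul_comm]
  · intro h
    choose! c hc using h
    refine ⟨fun i => ∏ p ∈ m.primeFactors, p ^ c p i, ?_⟩
    simp only [← Finset.prod_pow, ← pow_mul]
    rw [Finset.prod_comm]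
    conv_rhs => rw [← Nat.prod_factorization_pow_eq_self hm]
    refine Finset.prod_congr rfl fun p hp => ?_
    rw [Finset.prod_pow_eq_pow_sum, hc p (Nat.prime_of_mem_primeFactors hp)]

theorem Int.exists_prod_pow_eq_iff {ι : Type*} [Fintype ι] (k : ι → ℕ) {d : ℤ} (hd : d ≠ 0) :
    (∃ x : ι → ℤ, ∏ i, x i ^ k i = d) ↔
      (0 < d ∨ ∃ i, Odd (k i)) ∧ ∃ y : ι → ℕ, ∏ i, y i ^ k i = d.natAbs := by
  constructor
  · rintro ⟨x, rfl⟩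
    refine ⟨?_, fun i => (x i).natAbs, ?_⟩
    · by_contra! h
      refine hd (h.1.antisymm (Finset.prod_nonneg fun i _ => ?_))
      exact (Nat.not_odd_iff_even.mp (h.2 i)).pow_nonneg _
    · simp only [← Int.natAbs_pow]
      exact (map_prod Int.natAbsHom (fun i => x i ^ k i) Finset.univ).symm
  · rintro ⟨hsign, y, hy⟩
    have hy' : ∏ i, (y i : ℤ) ^ k i = |d| := by
      rw [Int.abs_eq_natAbs, ← hy]
      push_cast
      rfl
    rcases hd.lt_or_gt with hneg | hpos
    · obtain ⟨j, hj⟩ := hsign.resolve_left hneg.not_gt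
      classical
      refine ⟨fun i => (if i = j then -1 else 1) * y i, ?_⟩
      simp only [mul_pow, Finset.prod_mul_distrib, hy', ite_pow, one_pow]
      simp [hj.neg_one_pow, abs_of_neg hneg]
    · exact ⟨fun i => y i, by rw [hy', abs_of_pos hpos]⟩


/-- Solvability criterion for two-monomial equations: for nonzero integers a, b,
n ≥ 1 and positive integers k₁, …, kₙ, the equation a·x₁^{k₁}·…·xₙ^{kₙ} = b has
an integer solution if and only if a divides b, either b/a > 0 or some kᵢ is
odd, and for every prime p the p-adic valuation of |b/a| lies in the additive
submonoid generated by k₁, …, kₙ. -/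
theorem two_monomial_solvability (a b : ℤ) (ha : a ≠ 0) (hb : b ≠ 0)
    (n : ℕ) (hn : 1 ≤ n) (k : Fin n → ℕ) (hk : ∀ i, 0 < k i) :
    (∃ x : Fin n → ℤ, a * ∏ i, x i ^ k i = b) ↔
      (a ∣ b ∧ (0 < b / a ∨ ∃ i, Odd (k i)) ∧
        ∀ p : ℕ, p.Prime →
          ∃ c : Fin n → ℕ, (b / a).natAbs.factorization p = ∑ i, c i * k i) := by
  constructor
  · rintro ⟨x, rfl⟩
    have hd : ∏ i, x i ^ k i ≠ 0 := right_ne_zero_of_mul hb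
    rw [Int.mul_ediv_cancel_left _ ha,
      ← Nat.exists_prod_pow_eq_iff k (Int.natAbs_ne_zero.mpr hd)]
    exact ⟨dvd_mul_right _ _, (Int.exists_prod_pow_eq_iff k hd).mp ⟨x, rfl⟩⟩
  · rintro ⟨⟨d, rfl⟩, h⟩
    have hd : d ≠ 0 := right_ne_zero_of_mul hb
    rw [Int.mul_ediv_cancel_left _ ha,
      ← Nat.exists_prod_pow_eq_iff k (Int.natAbs_ne_zero.mpr hd)] at h
    obtain ⟨x, hx⟩ := (Int.exists_prod_pow_eq_iff k hd).mpr h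
    exact ⟨x, by rw [hx]⟩
end
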